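/- Threshold rigidity: there is no continuously differentiable f : ℝ³ → ℂ with f ∈ L²(ℝ³) ∩ L⁴(ℝ³) ∩ L⁶(ℝ³) and ∇f ∈ L²(ℝ³) such that E(f) = E^c(W) and ‖∇f‖_{L²} = ‖∇W‖_{L²}. -/

import Mathlib

open MeasureTheory Complex
open scoped BigOperators ENNReal

noncomputable section

abbrev E3 := EuclideanSpace ℝ (Fin 3)

/-- The Aubin–Talenti ground state `W(x) = (1 + |x|²/3)^(-1/2)`. -/
def W (x : E3) : ℝ := (1 + ‖x‖ ^ 2 / 3) ^ (-(1 : ℝ) / 2)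

/-- `W` viewed as a complex-valued function. -/
def Wc (x : E3) : ℂ := (W x : ℂ)

/-- Standard basis vectors of ℝ³. -/
def e3 (i : Fin 3) : E3 := EuclideanSpace.single i 1

/-- Partial derivative of a real-valued function. -/
def pdR (i : Fin 3) (f : E3 → ℝ) (x : E3) : ℝ := fderiv ℝ f x (e3 i)

/-- Partial derivative of a complex-valued function. -/
def pdC (i : Fin 3) (f : E3 → ℂ) (x : E3) : ℂ := fderiv ℝ f x (e3 i)

/-- Squared gradient `|∇f|²` of a real-valued function. -/
def gradSqR (f : E3 → ℝ) (x : E3) : ℝ := ∑ i, (pdR i f x) ^ 2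

/-- Squared gradient `|∇f|²` of a complex-valued function. -/
def gradSqC (f : E3 → ℂ) (x : E3) : ℝ := ∑ i, ‖pdC i f x‖ ^ 2

/-- Laplacian of a real-valued function. -/
def lapR (f : E3 → ℝ) (x : E3) : ℝ := ∑ i, pdR i (pdR i f) x

/-- Laplacian of a complex-valued function. -/
def lapC (f : E3 → ℂ) (x : E3) : ℂ := ∑ i, pdC i (pdC i f) x

/-- Quintic (energy-critical) energy `E^c`. -/
def Ecrit (f : E3 → ℂ) : ℝ := ∫ x : E3, ((1:ℝ)/2 * gradSqC f x - 1/6 * ‖f x‖ ^ 6)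

/-- Cubic–quintic energy `E`. -/
def Ecq (f : E3 → ℂ) : ℝ :=
  ∫ x : E3, ((1:ℝ)/2 * gradSqC f x - 1/6 * ‖f x‖ ^ 6 + 1/4 * ‖f x‖ ^ 4)

/-- Regular solutions of the cubic–quintic NLS on an interval `I ⊆ ℝ`. -/
def IsRegularSolution (I : Set ℝ) (u : ℝ → E3 → ℂ) : Prop :=
  ContDiffOn ℝ (⊤ : ℕ∞) (fun p : ℝ × E3 => u p.1 p.2) (I ×ˢ Set.univ) ∧
  (∀ t ∈ I, ∀ x : E3, Complex.I * deriv (fun s => u s x) t + lapC (u t) x =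
      (‖u t x‖ : ℂ) ^ 2 * u t x - (‖u t x‖ : ℂ) ^ 4 * u t x) ∧
  (∀ J : Set ℝ, IsCompact J → J ⊆ I → ∀ n k : ℕ, ∃ C : ℝ, ∀ t ∈ J, ∀ x : E3,
      (1 + ‖x‖) ^ n * ‖iteratedFDeriv ℝ k (u t) x‖ ≤ C)

/-- One-dimensional Brunn–Minkowski inequality for `A + B ⊆ C`. -/
lemma volume_add_le_of_add_mem {A B C : Set ℝ} (hA : MeasurableSet A) (hB : MeasurableSet B)
    (hA0 : A.Nonempty) (hB0 : B.Nonempty) (h : ∀ x ∈ A, ∀ y ∈ B, x + y ∈ C) :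
    volume A + volume B ≤ volume C := by
  have key : ∀ K ⊆ A, IsCompact K → K.Nonempty → ∀ L ⊆ B, IsCompact L → L.Nonempty →
      volume K + volume L ≤ volume C := by
    intro K hKA hK hK0 L hLB hL hL0
    obtain ⟨p, hp, hpmax⟩ := hK.exists_isGreatest hK0
    obtain ⟨q, hq, hqmin⟩ := hL.exists_isLeast hL0
    have h1 : volume ((fun x => x + q) '' K) = volume K := by simp
    have h2 : volume ((fun x => p + x) '' L \ {p + q}) = volume L := by
      rw [measure_sdiff_null (by simp)]
      simp
    rw [← h1, ← h2, ← measure_union]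
    · apply measure_mono
      rintro _ (⟨x, hx, rfl⟩ | ⟨⟨x, hx, rfl⟩, -⟩)
      · exact h _ (hKA hx) _ (hLB hq)
      · exact h _ (hKA hp) _ (hLB hx)
    · rw [Set.disjoint_left]
      rintro _ ⟨x, hx, rfl⟩ ⟨⟨y, hy, hxy⟩, hne⟩
      have e1 := hpmax hx
      have e2 := hqmin hy
      apply hne
      simp only at hxy
      simp only [Set.mem_singleton_iff]
      linarith
    · exact ((hL.image (by fun_prop)).measurableSet).diff (measurableSet_singleton _)
  obtain ⟨a, ha⟩ := hA0
  obtain ⟨b, hb⟩ := hB0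
  by_contra! hlt
  obtain ⟨r, hr, s, hs, hrs⟩ : ∃ K, (K ⊆ A ∧ IsCompact K) ∧ ∃ L, (L ⊆ B ∧ IsCompact L) ∧
      volume C < volume K + volume L := by
    by_contra! hcon
    have hle : volume A + volume B ≤ volume C := by
      rw [hA.measure_eq_iSup_isCompact, hB.measure_eq_iSup_isCompact]
      simp only [iSup_and']
      refine ENNReal.biSup_add_biSup_le' ⟨∅, by simp⟩ ⟨∅, by simp⟩ ?_
      intro K hK L hL
      exact hcon K hK L hL
    exact absurd hlt (not_lt.mpr hle)
  have := key (insert a r) (Set.insert_subset ha hr.1) (hr.2.insert a) ⟨a, by simp⟩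
    (insert b s) (Set.insert_subset hb hs.1) (hs.2.insert b) ⟨b, by simp⟩
  have h3 : volume r + volume s ≤ volume (insert a r) + volume (insert b s) := by
    gcongr <;> exact Set.subset_insert _ _
  exact absurd (hrs.trans_le h3) (not_lt.mpr this)

lemma volume_add_mul_le_of_add_mem {A B C : Set ℝ} {t : ℝ} (ht : 0 < t) (hA : MeasurableSet A)
    (hB : MeasurableSet B) (hA0 : A.Nonempty) (hB0 : B.Nonempty)
    (h : ∀ x ∈ A, ∀ y ∈ B, x + t * y ∈ C) :
    volume A + ENNReal.ofReal t * volume B ≤ volume C := by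
  open Pointwise in
  have h1 : volume (t • B) = ENNReal.ofReal t * volume B := by
    rw [Measure.addHaar_smul]
    simp [abs_of_pos ht]
  rw [← h1]
  refine volume_add_le_of_add_mem hA (hB.const_smul_of_ne_zero ht.ne') hA0 hB0.smul_set ?_
  rintro x hx _ ⟨y, hy, rfl⟩
  exact h x hx y hy

/-- Superlevel-set form of the one-dimensional Prékopa–Leindler principle. -/
lemma lintegral_add_le_of_min_le {U V X : ℝ → ℝ≥0∞} (hU : Measurable U) (hV : Measurable V)
    (hX : Measurable X) {t : ℝ} (ht : 0 < t) (hU1 : ⨆ x, U x = 1) (hV1 : ⨆ x, V x = 1)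
    (h : ∀ x y, min (U x) (V y) ≤ X (x + t * y)) :
    (∫⁻ x, U x) + ENNReal.ofReal t * ∫⁻ x, V x ≤ ∫⁻ x, X x := by
  have hUle : ∀ x, U x ≤ 1 := fun x => hU1 ▸ le_iSup U x
  have hVle : ∀ x, V x ≤ 1 := fun x => hV1 ▸ le_iSup V x
  have layer : ∀ F : ℝ → ℝ≥0∞, Measurable F → (∀ x, F x ≤ 1) →
      ∫⁻ x, F x = ∫⁻ s in Set.Ioo (0 : ℝ) 1, volume {x | ENNReal.ofReal s < F x} := by
    intro F hF hF1
    have hfin : ∀ x, F x ≠ ∞ := fun x => ((hF1 x).trans_lt ENNReal.one_lt_top).ne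
    have h1 : ∫⁻ x, F x = ∫⁻ x, ENNReal.ofReal (F x).toReal :=
      lintegral_congr fun x => (ENNReal.ofReal_toReal (hfin x)).symm
    rw [h1, lintegral_eq_lintegral_meas_lt _ (Filter.Eventually.of_forall fun x => by simp)
      hF.ennreal_toReal.aemeasurable]
    have h2 : ∀ s ∈ Set.Ioi (0 : ℝ), volume {x | s < (F x).toReal}
        = (Set.Ioo (0 : ℝ) 1).indicator (fun s => volume {x | ENNReal.ofReal s < F x}) s := by
      intro s hs
      by_cases hs1 : s < 1
      · rw [Set.indicator_of_mem (show s ∈ Set.Ioo (0 : ℝ) 1 from ⟨hs, hs1⟩)]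
        congr 1
        ext x
        simp only [Set.mem_ofPred_eq]
        rw [ENNReal.ofReal_lt_iff_lt_toReal (le_of_lt hs) (hfin x)]
      · rw [Set.indicator_of_notMem (fun hc => hs1 hc.2)]
        convert measure_empty (μ := (volume : Measure ℝ))
        ext x
        simp only [Set.mem_ofPred_eq, Set.mem_empty_iff_false, iff_false, not_lt]
        exact (ENNReal.toReal_mono ENNReal.one_ne_top (hF1 x)).trans (by simpa using hs1)
    rw [setLIntegral_congr_fun measurableSet_Ioi h2, lintegral_indicator measurableSet_Ioo,
      Measure.restrict_restrict measurableSet_Ioo]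
    congr 2
    ext s; simp +contextual
  have hXm : Measurable fun x => min (X x) 1 := hX.min measurable_const
  refine le_trans ?_ (lintegral_mono fun x => min_le_left (X x) 1)
  rw [layer U hU hUle, layer V hV hVle, layer _ hXm fun x => min_le_right _ _]
  have hanti : ∀ F : ℝ → ℝ≥0∞, Measurable fun s : ℝ => volume {x | ENNReal.ofReal s < F x} := by
    intro F
    refine Antitone.measurable fun s s' hss' => measure_mono fun x hx => ?_
    exact (ENNReal.ofReal_le_ofReal hss').trans_lt hx
  rw [← lintegral_const_mul _ (hanti V), ← lintegral_add_left (hanti U)]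
  refine setLIntegral_mono (hanti _) fun s hs => ?_
  have hs1 : ENNReal.ofReal s < 1 := by simpa using hs.2
  obtain ⟨p, hp⟩ := lt_iSup_iff.mp (hs1.trans_eq hU1.symm)
  obtain ⟨q, hq⟩ := lt_iSup_iff.mp (hs1.trans_eq hV1.symm)
  refine volume_add_mul_le_of_add_mem ht (measurableSet_lt measurable_const hU)
    (measurableSet_lt measurable_const hV) ⟨p, hp⟩ ⟨q, hq⟩ fun x hx y hy => ?_
  simp only [Set.mem_ofPred_eq] at *
  exact lt_min ((lt_min hx hy).trans_le (h x y)) hs1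

lemma lintegral_div_add_le_of_min_le {U V X : ℝ → ℝ≥0∞} (hU : Measurable U) (hV : Measurable V)
    (hX : Measurable X) {t : ℝ} (ht : 0 < t) {a b c : ℝ≥0∞} (hUa : ⨆ x, U x = a)
    (hVb : ⨆ x, V x = b) (ha0 : a ≠ 0) (ha : a ≠ ∞) (hb0 : b ≠ 0) (hb : b ≠ ∞) (hc0 : c ≠ 0)
    (hc : c ≠ ∞) (h : ∀ x y, c * min (U x / a) (V y / b) ≤ X (x + t * y)) :
    c * ((∫⁻ x, U x) / a + ENNReal.ofReal t * ((∫⁻ x, V x) / b)) ≤ ∫⁻ x, X x := by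
  have key := lintegral_add_le_of_min_le (U := fun x => U x / a) (V := fun x => V x / b)
    (X := fun x => X x / c) (hU.div_const a) (hV.div_const b) (hX.div_const c) ht
    (by rw [← ENNReal.iSup_div, hUa, ENNReal.div_self ha0 ha])
    (by rw [← ENNReal.iSup_div, hVb, ENNReal.div_self hb0 hb])
    (fun x y => by
      rw [ENNReal.le_div_iff_mul_le (Or.inl hc0) (Or.inl hc), mul_comm]
      exact h x y)
  simp only [ENNReal.div_eq_inv_mul] at key ⊢
  rw [lintegral_const_mul _ hU, lintegral_const_mul _ hV, lintegral_const_mul _ hX] at key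
  calc _ ≤ c * (c⁻¹ * ∫⁻ x, X x) := by gcongr
    _ = _ := by rw [← mul_assoc, ENNReal.mul_inv_cancel hc0 hc, one_mul]

/-- The inequality underlying the passage from exponent `-1/2` to exponent `-1` in
one-dimensional Borell–Brascamp–Lieb. -/
lemma inv_add_inv_le_lintegral {g h w : ℝ → ℝ} (hg : Measurable g) (hh : Measurable h)
    (hw : Measurable w) {m : ℝ} (hm : 0 < m) (hgm : ∀ x, m ≤ g x) (hhm : ∀ x, m ≤ h x)
    (hw0 : ∀ x, 0 < w x) {t : ℝ} (ht : 0 < t) (hgh : ∀ x y, w (x + t * y) ≤ g x + t * h y)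
    (hP : ∫⁻ x, ENNReal.ofReal ((g x ^ 2)⁻¹) ≠ ∞) (hQ : ∫⁻ x, ENNReal.ofReal ((h x ^ 2)⁻¹) ≠ ∞) :
    ((∫⁻ x, ENNReal.ofReal ((g x ^ 2)⁻¹))⁻¹
      + ENNReal.ofReal t * (∫⁻ x, ENNReal.ofReal ((h x ^ 2)⁻¹))⁻¹)⁻¹
      ≤ ∫⁻ x, ENNReal.ofReal ((w x ^ 2)⁻¹) := by
  have aux : ∀ g : ℝ → ℝ, Measurable g → (∀ x, m ≤ g x) →
      ∫⁻ x, ENNReal.ofReal ((g x ^ 2)⁻¹) ≠ ∞ →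
      ∃ α P : ℝ, 0 < α ∧ 0 < P ∧ ⨆ x, ENNReal.ofReal ((g x ^ 2)⁻¹) = ENNReal.ofReal ((α ^ 2)⁻¹) ∧
        ∫⁻ x, ENNReal.ofReal ((g x ^ 2)⁻¹) = ENNReal.ofReal P := by
    intro g hg hgm hP
    have hsup : ⨆ x, ENNReal.ofReal ((g x ^ 2)⁻¹) ≤ ENNReal.ofReal ((m ^ 2)⁻¹) :=
      iSup_le fun x => ENNReal.ofReal_le_ofReal (by gcongr; exact hgm x)
    have hpos : ∀ x, 0 < ENNReal.ofReal ((g x ^ 2)⁻¹) := fun x =>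
      ENNReal.ofReal_pos.mpr (by have := hm.trans_le (hgm x); positivity)
    have hsup0 : 0 < ⨆ x, ENNReal.ofReal ((g x ^ 2)⁻¹) := (hpos 0).trans_le
      (le_iSup (fun x => ENNReal.ofReal ((g x ^ 2)⁻¹)) 0)
    have hfin : ⨆ x, ENNReal.ofReal ((g x ^ 2)⁻¹) ≠ ∞ := (hsup.trans_lt ENNReal.ofReal_lt_top).ne
    have hP0 : 0 < ∫⁻ x, ENNReal.ofReal ((g x ^ 2)⁻¹) := by
      rw [lintegral_pos_iff_support (by fun_prop)]
      have : Function.support (fun x => ENNReal.ofReal ((g x ^ 2)⁻¹)) = Set.univ := by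
        ext x; simpa using (hpos x).ne'
      rw [this]; simp
    have hs := ENNReal.toReal_pos hsup0.ne' hfin
    refine ⟨(√(⨆ x, ENNReal.ofReal ((g x ^ 2)⁻¹)).toReal)⁻¹, _, by positivity,
      ENNReal.toReal_pos hP0.ne' hP, ?_, (ENNReal.ofReal_toReal hP).symm⟩
    rw [inv_pow, inv_inv, Real.sq_sqrt hs.le, ENNReal.ofReal_toReal hfin]
  obtain ⟨α, P, hα, hP0, hα1, hP1⟩ := aux g hg hgm hP
  obtain ⟨β, Q, hβ, hQ0, hβ1, hQ1⟩ := aux h hh hhm hQ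
  have hαβ : 0 < α + t * β := by positivity
  have key := lintegral_div_add_le_of_min_le (U := fun x => ENNReal.ofReal ((g x ^ 2)⁻¹))
    (V := fun x => ENNReal.ofReal ((h x ^ 2)⁻¹)) (X := fun x => ENNReal.ofReal ((w x ^ 2)⁻¹))
    (by fun_prop) (by fun_prop) (by fun_prop) ht hα1 hβ1
    (by rw [← pos_iff_ne_zero, ENNReal.ofReal_pos]; positivity) ENNReal.ofReal_ne_top
    (by rw [← pos_iff_ne_zero, ENNReal.ofReal_pos]; positivity) ENNReal.ofReal_ne_top
    (c := ENNReal.ofReal (((α + t * β) ^ 2)⁻¹))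
    (by rw [← pos_iff_ne_zero, ENNReal.ofReal_pos]; positivity) ENNReal.ofReal_ne_top
    (by
      intro x y
      have hgx := hm.trans_le (hgm x)
      have hhy := hm.trans_le (hhm y)
      have hwx := hw0 (x + t * y)
      have hle := hgh x y
      rw [← ENNReal.ofReal_div_of_pos (by positivity), ← ENNReal.ofReal_div_of_pos (by positivity),
        ← ENNReal.ofReal_min, ← ENNReal.ofReal_mul (by positivity)]
      apply ENNReal.ofReal_le_ofReal
      have e1 : (g x ^ 2)⁻¹ / (α ^ 2)⁻¹ = ((g x / α) ^ 2)⁻¹ := by field_simp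
      have e2 : (h y ^ 2)⁻¹ / (β ^ 2)⁻¹ = ((h y / β) ^ 2)⁻¹ := by field_simp
      rw [e1, e2]
      have step : ∀ r, 0 < r → g x ≤ r * α → h y ≤ r * β →
          ((α + t * β) ^ 2)⁻¹ * (r ^ 2)⁻¹ ≤ (w (x + t * y) ^ 2)⁻¹ := by
        intro r hr h1 h2
        rw [← mul_inv, ← mul_pow]
        gcongr
        nlinarith
      rcases le_total (g x / α) (h y / β) with hc | hc
      · refine le_trans (mul_le_mul_of_nonneg_left (min_le_right _ _) (by positivity)) ?_
        refine step _ (by positivity) ?_ ?_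
        · rwa [← div_le_iff₀ hα]
        · rw [div_mul_cancel₀ _ hβ.ne']
      · refine le_trans (mul_le_mul_of_nonneg_left (min_le_left _ _) (by positivity)) ?_
        refine step _ (by positivity) ?_ ?_
        · rw [div_mul_cancel₀ _ hα.ne']
        · rwa [← div_le_iff₀ hβ])
  refine le_trans ?_ key
  rw [hP1, hQ1, ← ENNReal.ofReal_inv_of_pos hP0, ← ENNReal.ofReal_inv_of_pos hQ0,
    ← ENNReal.ofReal_mul ht.le, ← ENNReal.ofReal_add (by positivity) (by positivity),
    ← ENNReal.ofReal_inv_of_pos (by positivity), ← ENNReal.ofReal_div_of_pos (by positivity),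
    ← ENNReal.ofReal_div_of_pos (by positivity), ← ENNReal.ofReal_mul ht.le,
    ← ENNReal.ofReal_add (by positivity) (by positivity), ← ENNReal.ofReal_mul (by positivity)]
  apply ENNReal.ofReal_le_ofReal
  rw [inv_le_iff_one_le_mul₀ (by positivity), ← sub_nonneg]
  have : ((α + t * β) ^ 2)⁻¹ * (P / (α ^ 2)⁻¹ + t * (Q / (β ^ 2)⁻¹)) * (P⁻¹ + t * Q⁻¹) - 1
    = t * (P * α - Q * β) ^ 2 / (P * Q * (α + t * β) ^ 2) := by
    field_simp
    ring
  rw [this]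
  positivity

/-- One-dimensional Borell–Brascamp–Lieb inequality with exponent `-1`. -/
lemma min_lintegral_le_lintegral {P Q R : ℝ → ℝ≥0∞} (hP : Measurable P) (hQ : Measurable Q)
    (hR : Measurable R) {t : ℝ} (ht : 0 < t) (hP0 : ⨆ x, P x ≠ 0) (hPt : ⨆ x, P x ≠ ∞)
    (hQ0 : ⨆ x, Q x ≠ 0) (hQt : ⨆ x, Q x ≠ ∞)
    (h : ∀ x y, ((P x)⁻¹ + ENNReal.ofReal t * (Q y)⁻¹)⁻¹ ≤ R (x + t * y)) :
    min (∫⁻ x, P x) (∫⁻ x, Q x) ≤ ∫⁻ x, R x := by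
  set a := ⨆ x, P x with ha
  set b := ⨆ x, Q x with hb
  have hS0 : a⁻¹ + ENNReal.ofReal t * b⁻¹ ≠ 0 := by simp [hPt]
  have hSt : a⁻¹ + ENNReal.ofReal t * b⁻¹ ≠ ∞ := by
    simp [hP0, ENNReal.mul_eq_top, hQ0]
  have key := lintegral_div_add_le_of_min_le hP hQ hR ht ha.symm hb.symm hP0 hPt hQ0 hQt
    (c := (a⁻¹ + ENNReal.ofReal t * b⁻¹)⁻¹) (ENNReal.inv_ne_zero.mpr hSt) (ENNReal.inv_ne_top.mpr hS0) (by
      intro x y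
      refine le_trans ?_ (h x y)
      set r := min (P x / a) (Q y / b) with hr
      have h1 : r * a ≤ P x :=
        (mul_le_mul_left (min_le_left _ _) a).trans (ENNReal.div_mul_cancel hP0 hPt).le
      have h2 : r * b ≤ Q y :=
        (mul_le_mul_left (min_le_right _ _) b).trans (ENNReal.div_mul_cancel hQ0 hQt).le
      by_cases hr0 : r = 0
      · simp [hr0]
      have hrt : r ≠ ∞ := by
        have : r ≤ 1 := (min_le_left _ _).trans ((ENNReal.div_le_div_right (le_iSup P x) a).trans
          ENNReal.div_self_le_one)
        exact (this.trans_lt ENNReal.one_lt_top).ne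
      have h3 : (P x)⁻¹ ≤ r⁻¹ * a⁻¹ := by
        rw [← ENNReal.mul_inv (Or.inl hr0) (Or.inl hrt)]
        exact ENNReal.inv_le_inv.mpr h1
      have h4 : (Q y)⁻¹ ≤ r⁻¹ * b⁻¹ := by
        rw [← ENNReal.mul_inv (Or.inl hr0) (Or.inl hrt)]
        exact ENNReal.inv_le_inv.mpr h2
      calc (a⁻¹ + ENNReal.ofReal t * b⁻¹)⁻¹ * r
          = (r⁻¹ * a⁻¹ + ENNReal.ofReal t * (r⁻¹ * b⁻¹))⁻¹ := by
            rw [mul_left_comm, ← mul_add, ENNReal.mul_inv (Or.inr hSt) (Or.inr hS0), inv_inv,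
              mul_comm]
        _ ≤ _ := by gcongr)
  refine le_trans ?_ key
  calc min (∫⁻ x, P x) (∫⁻ x, Q x) = (a⁻¹ + ENNReal.ofReal t * b⁻¹)⁻¹ *
        (min (∫⁻ x, P x) (∫⁻ x, Q x) * (a⁻¹ + ENNReal.ofReal t * b⁻¹)) := by
        rw [mul_comm (min _ _), ← mul_assoc, ENNReal.inv_mul_cancel hS0 hSt, one_mul]
    _ ≤ _ := by
        rw [mul_add, mul_left_comm]
        simp only [div_eq_mul_inv]
        gcongr
        · exact min_le_left _ _
        · exact min_le_right _ _

lemma lintegral_add_le_of_min_le_of_iSup_eq {P Q R : ℝ → ℝ≥0∞} (hP : Measurable P)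
    (hQ : Measurable Q) (hR : Measurable R) {t : ℝ} (ht : 0 < t) (hP0 : ⨆ x, P x ≠ 0)
    (hPt : ⨆ x, P x ≠ ∞) (hPQ : ⨆ x, P x = ⨆ x, Q x)
    (h : ∀ x y, min (P x) (Q y) ≤ R (x + t * y)) :
    (∫⁻ x, P x) + ENNReal.ofReal t * ∫⁻ x, Q x ≤ ∫⁻ x, R x := by
  have hc : ∀ x, (⨆ x, P x) * (x / ⨆ x, P x) = x := fun x => ENNReal.mul_div_cancel hP0 hPt
  have key := lintegral_div_add_le_of_min_le hP hQ hR ht rfl hPQ.symm hP0 hPt hP0 hPt hP0 hPt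
    (by
      intro x y
      rw [mul_min, hc, hc]
      exact h x y)
  rwa [mul_add, hc, mul_left_comm, hc] at key

lemma lintegral_inv_one_add_sq :
    ∫⁻ x : ℝ, ENNReal.ofReal ((1 + x ^ 2)⁻¹) = ENNReal.ofReal Real.pi := by
  rw [← integral_univ_inv_one_add_sq, ofReal_integral_eq_lintegral_ofReal
    integrable_inv_one_add_sq (Filter.Eventually.of_forall fun x => by positivity)]

lemma inv_sq_le_of_mul_le {c r x y z : ℝ} (hc : 0 < c) (h : c * (1 + x ^ 2 + y ^ 2 + z ^ 2) ≤ r) :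
    (r ^ 2)⁻¹ ≤ (c ^ 2)⁻¹ * ((1 + y ^ 2)⁻¹ * (1 + z ^ 2)⁻¹) := by
  rw [← mul_inv, ← mul_inv]
  gcongr
  calc c ^ 2 * ((1 + y ^ 2) * (1 + z ^ 2)) ≤ (c * (1 + x ^ 2 + y ^ 2 + z ^ 2)) ^ 2 := by
        rw [mul_pow]
        gcongr
        nlinarith [sq_nonneg x, sq_nonneg y, sq_nonneg z, mul_nonneg (sq_nonneg y) (sq_nonneg z),
          sq_nonneg (x ^ 2 + y ^ 2 + z ^ 2)]
    _ ≤ r ^ 2 := by gcongr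

lemma lintegral_inv_sq_le {g : ℝ → ℝ} {c x y : ℝ} (hc : 0 < c)
    (h : ∀ z, c * (1 + x ^ 2 + y ^ 2 + z ^ 2) ≤ g z) :
    ∫⁻ z, ENNReal.ofReal ((g z ^ 2)⁻¹) ≤
      ENNReal.ofReal ((c ^ 2)⁻¹ * Real.pi) * ENNReal.ofReal ((1 + y ^ 2)⁻¹) := by
  calc ∫⁻ z, ENNReal.ofReal ((g z ^ 2)⁻¹)
      ≤ ∫⁻ z, ENNReal.ofReal ((c ^ 2)⁻¹ * (1 + y ^ 2)⁻¹) * ENNReal.ofReal ((1 + z ^ 2)⁻¹) := by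
        refine lintegral_mono fun z => ?_
        rw [← ENNReal.ofReal_mul (by positivity), mul_assoc]
        exact ENNReal.ofReal_le_ofReal (inv_sq_le_of_mul_le hc (h z))
    _ = _ := by
        rw [lintegral_const_mul _ (by fun_prop), lintegral_inv_one_add_sq,
          ← ENNReal.ofReal_mul (by positivity), ← ENNReal.ofReal_mul (by positivity)]
        congr 1; ring

lemma lintegral_lintegral_inv_sq_le {g : ℝ → ℝ → ℝ} {c x : ℝ} (hc : 0 < c)
    (h : ∀ y z, c * (1 + x ^ 2 + y ^ 2 + z ^ 2) ≤ g y z) :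
    ∫⁻ y, ∫⁻ z, ENNReal.ofReal ((g y z ^ 2)⁻¹) ≤
      ENNReal.ofReal ((c ^ 2)⁻¹ * Real.pi) * ENNReal.ofReal Real.pi := by
  rw [← lintegral_inv_one_add_sq, ← lintegral_const_mul _ (by fun_prop)]
  exact lintegral_mono fun y => lintegral_inv_sq_le hc (h y)

lemma lintegral_pos_of_forall_pos {F : ℝ → ℝ≥0∞} (hF : Measurable F) (h : ∀ x, 0 < F x) :
    0 < ∫⁻ x, F x := by
  rw [lintegral_pos_iff_support hF, show Function.support F = Set.univ from
    Set.eq_univ_of_forall fun x => (h x).ne']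
  simp

/-- Borell–Brascamp–Lieb inequality in dimension three, in the strengthened form that assumes
equality of the maximal planar marginals. -/
lemma lintegral_inv_sq_add_le {g h w : ℝ → ℝ → ℝ → ℝ}
    (hg : Measurable fun p : ℝ × ℝ × ℝ => g p.1 p.2.1 p.2.2)
    (hh : Measurable fun p : ℝ × ℝ × ℝ => h p.1 p.2.1 p.2.2)
    (hw : Measurable fun p : ℝ × ℝ × ℝ => w p.1 p.2.1 p.2.2) {c : ℝ} (hc : 0 < c)
    (hgc : ∀ x y z, c * (1 + x ^ 2 + y ^ 2 + z ^ 2) ≤ g x y z)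
    (hhc : ∀ x y z, c * (1 + x ^ 2 + y ^ 2 + z ^ 2) ≤ h x y z)
    (hw0 : ∀ x y z, 0 < w x y z) {t : ℝ} (ht : 0 < t)
    (hgh : ∀ x y z x' y' z', w (x + t * x') (y + t * y') (z + t * z') ≤
      g x y z + t * h x' y' z')
    (hmarg : ⨆ x, ∫⁻ y, ∫⁻ z, ENNReal.ofReal ((g x y z ^ 2)⁻¹) =
      ⨆ x, ∫⁻ y, ∫⁻ z, ENNReal.ofReal ((h x y z ^ 2)⁻¹)) :
    (∫⁻ x, ∫⁻ y, ∫⁻ z, ENNReal.ofReal ((g x y z ^ 2)⁻¹)) +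
      ENNReal.ofReal t * (∫⁻ x, ∫⁻ y, ∫⁻ z, ENNReal.ofReal ((h x y z ^ 2)⁻¹)) ≤
      ∫⁻ x, ∫⁻ y, ∫⁻ z, ENNReal.ofReal ((w x y z ^ 2)⁻¹) := by
  have meas1 : ∀ g : ℝ → ℝ → ℝ → ℝ, Measurable (fun p : ℝ × ℝ × ℝ => g p.1 p.2.1 p.2.2) →
      Measurable fun p : ℝ × ℝ => ∫⁻ z, ENNReal.ofReal ((g p.1 p.2 z ^ 2)⁻¹) := by
    intro g hg
    refine Measurable.lintegral_prod_right' (f := fun q : (ℝ × ℝ) × ℝ =>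
      ENNReal.ofReal ((g q.1.1 q.1.2 q.2 ^ 2)⁻¹)) ?_
    have : Measurable fun q : (ℝ × ℝ) × ℝ => g q.1.1 q.1.2 q.2 :=
      hg.comp (g := fun p : ℝ × ℝ × ℝ => g p.1 p.2.1 p.2.2)
        (f := fun q : (ℝ × ℝ) × ℝ => (q.1.1, q.1.2, q.2)) (by fun_prop)
    fun_prop
  have meas2 : ∀ g : ℝ → ℝ → ℝ → ℝ, Measurable (fun p : ℝ × ℝ × ℝ => g p.1 p.2.1 p.2.2) →
      Measurable fun x : ℝ => ∫⁻ y, ∫⁻ z, ENNReal.ofReal ((g x y z ^ 2)⁻¹) := fun g hg =>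
    Measurable.lintegral_prod_right' (f := fun p : ℝ × ℝ =>
      ∫⁻ z, ENNReal.ofReal ((g p.1 p.2 z ^ 2)⁻¹)) (meas1 g hg)
  have meas0 : ∀ g : ℝ → ℝ → ℝ → ℝ, Measurable (fun p : ℝ × ℝ × ℝ => g p.1 p.2.1 p.2.2) →
      ∀ x y, Measurable fun z => g x y z := fun g hg x y =>
    hg.comp (g := fun p : ℝ × ℝ × ℝ => g p.1 p.2.1 p.2.2) (f := fun z => (x, y, z)) (by fun_prop)
  have lower : ∀ g : ℝ → ℝ → ℝ → ℝ, (∀ x y z, c * (1 + x ^ 2 + y ^ 2 + z ^ 2) ≤ g x y z) →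
      ∀ x y z, c ≤ g x y z := fun g hgc x y z =>
    le_trans (by nlinarith [sq_nonneg x, sq_nonneg y, sq_nonneg z]) (hgc x y z)
  have pos1 : ∀ g : ℝ → ℝ → ℝ → ℝ, Measurable (fun p : ℝ × ℝ × ℝ => g p.1 p.2.1 p.2.2) →
      (∀ x y z, c * (1 + x ^ 2 + y ^ 2 + z ^ 2) ≤ g x y z) →
      ∀ x y, 0 < ∫⁻ z, ENNReal.ofReal ((g x y z ^ 2)⁻¹) := by
    intro g hg hgc x y
    have := meas0 g hg x y
    refine lintegral_pos_of_forall_pos (by fun_prop) fun z => ENNReal.ofReal_pos.mpr ?_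
    have := hc.trans_le (lower g hgc x y z)
    positivity
  have sup0 : ∀ F : ℝ → ℝ≥0∞, (∀ x, 0 < F x) → ⨆ x, F x ≠ 0 := fun F hF =>
    ((hF 0).trans_le (le_iSup F 0)).ne'
  have fin1 : ∀ g : ℝ → ℝ → ℝ → ℝ, (∀ x y z, c * (1 + x ^ 2 + y ^ 2 + z ^ 2) ≤ g x y z) →
      ∀ x, ⨆ y, ∫⁻ z, ENNReal.ofReal ((g x y z ^ 2)⁻¹) ≠ ∞ := by
    intro g hgc x
    refine ne_top_of_le_ne_top (b := ENNReal.ofReal ((c ^ 2)⁻¹ * Real.pi) * 1) (by simp)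
      (iSup_le fun y => (lintegral_inv_sq_le hc (hgc x y)).trans ?_)
    gcongr
    rw [ENNReal.ofReal_le_one]
    exact inv_le_one_of_one_le₀ (by nlinarith [sq_nonneg y])
  have fin2 : ⨆ x, ∫⁻ y, ∫⁻ z, ENNReal.ofReal ((g x y z ^ 2)⁻¹) ≠ ∞ :=
    ne_top_of_le_ne_top (by finiteness)
      (iSup_le fun x => lintegral_lintegral_inv_sq_le hc (hgc x))
  refine lintegral_add_le_of_min_le_of_iSup_eq (meas2 g hg) (meas2 h hh) (meas2 w hw) ht
    (sup0 _ fun x => lintegral_pos_of_forall_pos ((meas1 g hg).comp (f := fun y => (x, y))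
      (by fun_prop)) (pos1 g hg hgc x)) fin2 hmarg fun x x' => ?_
  have sl : ∀ g : ℝ → ℝ → ℝ → ℝ, Measurable (fun p : ℝ × ℝ × ℝ => g p.1 p.2.1 p.2.2) →
      ∀ x,
      Measurable fun y => ∫⁻ z, ENNReal.ofReal ((g x y z ^ 2)⁻¹) := fun g hg x =>
    (meas1 g hg).comp (f := fun y => (x, y)) (by fun_prop)
  refine min_lintegral_le_lintegral (sl g hg x) (sl h hh x') (sl w hw _) ht
    (sup0 _ (pos1 g hg hgc x)) (fin1 g hgc x) (sup0 _ (pos1 h hh hhc x')) (fin1 h hhc x')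
    fun y y' => ?_
  refine inv_add_inv_le_lintegral (meas0 g hg x y) (meas0 h hh x' y') (meas0 w hw _ _) hc
    (lower g hgc x y) (lower h hhc x' y') (hw0 _ _) ht (fun z z' => hgh x y z x' y' z') ?_ ?_
  · exact ne_top_of_le_ne_top (by finiteness) (lintegral_inv_sq_le hc (hgc x y))
  · exact ne_top_of_le_ne_top (by finiteness) (lintegral_inv_sq_le hc (hhc x' y'))

lemma lintegral_E3 {F : E3 → ℝ≥0∞} (hF : Measurable F) :
    ∫⁻ x, F x = ∫⁻ x, ∫⁻ y, ∫⁻ z, F !₂[x, y, z] := by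
  have h1 : ∫⁻ x, F x = ∫⁻ p : Fin 3 → ℝ, F (WithLp.toLp 2 p) :=
    ((PiLp.volume_preserving_toLp (Fin 3)).lintegral_comp hF).symm
  have hF1 : Measurable fun p : Fin 3 → ℝ => F (WithLp.toLp 2 p) := by fun_prop
  have h2 : ∫⁻ p : Fin 3 → ℝ, F (WithLp.toLp 2 p) = ∫⁻ q : ℝ × (Fin 2 → ℝ),
      F (WithLp.toLp 2 (Fin.cons q.1 q.2)) := by
    have := ((volume_preserving_piFinSuccAbove (fun _ : Fin 3 => ℝ) 0).symm).lintegral_comp hF1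
    rw [← this]
    refine lintegral_congr fun q => ?_
    congr 2
    exact Fin.insertNth_zero' _ _
  have hF2 : Measurable fun q : ℝ × (Fin 2 → ℝ) => F (WithLp.toLp 2 (Fin.cons q.1 q.2)) := by
    have : Measurable fun q : ℝ × (Fin 2 → ℝ) => (Fin.cons q.1 q.2 : Fin 3 → ℝ) := by
      rw [measurable_pi_iff]
      intro i
      refine Fin.cases ?_ (fun j => ?_) i <;> simp <;> fun_prop
    fun_prop
  rw [h1, h2, Measure.volume_eq_prod, lintegral_prod _ hF2.aemeasurable]
  refine lintegral_congr fun x => ?_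
  have hF3 : Measurable fun q : Fin 2 → ℝ => F (WithLp.toLp 2 (Fin.cons x q)) :=
    hF2.comp (f := fun q : Fin 2 → ℝ => (x, q)) (by fun_prop)
  rw [← ((volume_preserving_finTwoArrow ℝ).symm).lintegral_comp hF3, Measure.volume_eq_prod,
    lintegral_prod]
  · refine lintegral_congr fun y => lintegral_congr fun z => ?_
    congr 2
  · exact (hF3.comp (MeasurableEquiv.measurable _)).aemeasurable

/-- The largest integral of `F⁻²` over the planes orthogonal to the first coordinate axis. -/
def planeSup (F : E3 → ℝ) : ℝ≥0∞ := ⨆ x, ∫⁻ y, ∫⁻ z, ENNReal.ofReal ((F !₂[x, y, z] ^ 2)⁻¹)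

lemma norm_sq_vec (x y z : ℝ) : ‖(!₂[x, y, z] : E3)‖ ^ 2 = x ^ 2 + y ^ 2 + z ^ 2 := by
  rw [EuclideanSpace.norm_sq_eq]
  simp [Fin.sum_univ_three]

lemma vec_measurable : Measurable fun p : ℝ × ℝ × ℝ => (!₂[p.1, p.2.1, p.2.2] : E3) := by
  refine (PiLp.volume_preserving_toLp (Fin 3)).measurable.comp (measurable_pi_iff.mpr fun i => ?_)
  fin_cases i <;> simp <;> fun_prop

lemma lintegral_inv_sq_add_le_E3 {g h w : E3 → ℝ} (hg : Measurable g) (hh : Measurable h)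
    (hw : Measurable w) {c : ℝ} (hc : 0 < c) (hgc : ∀ x, c * (1 + ‖x‖ ^ 2) ≤ g x)
    (hhc : ∀ x, c * (1 + ‖x‖ ^ 2) ≤ h x) (hw0 : ∀ x, 0 < w x) {t : ℝ} (ht : 0 < t)
    (hgh : ∀ x y, w (x + t • y) ≤ g x + t * h y) (hmarg : planeSup g = planeSup h) :
    (∫⁻ x, ENNReal.ofReal ((g x ^ 2)⁻¹)) +
      ENNReal.ofReal t * (∫⁻ x, ENNReal.ofReal ((h x ^ 2)⁻¹)) ≤
      ∫⁻ x, ENNReal.ofReal ((w x ^ 2)⁻¹) := by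
  rw [lintegral_E3 (by fun_prop), lintegral_E3 (by fun_prop), lintegral_E3 (by fun_prop)]
  refine lintegral_inv_sq_add_le (g := fun x y z => g !₂[x, y, z])
    (h := fun x y z => h !₂[x, y, z]) (w := fun x y z => w !₂[x, y, z])
    (hg.comp vec_measurable) (hh.comp vec_measurable) (hw.comp vec_measurable) hc
    (fun x y z => ?_) (fun x y z => ?_) (fun x y z => hw0 _) ht (fun x y z x' y' z' => ?_) hmarg
  · have := hgc !₂[x, y, z]
    rw [norm_sq_vec] at this
    convert this using 2; ring
  · have := hhc !₂[x, y, z]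
    rw [norm_sq_vec] at this
    convert this using 2; ring
  · convert hgh !₂[x, y, z] !₂[x', y', z'] using 2
    ext i
    fin_cases i <;> simp

lemma planeSup_pos {F : E3 → ℝ} (hF : Measurable F) (h : ∀ x, 0 < F x) : 0 < planeSup F := by
  have m := hF.comp vec_measurable
  have m1 : Measurable fun p : ℝ × ℝ × ℝ => ENNReal.ofReal ((F !₂[p.1, p.2.1, p.2.2] ^ 2)⁻¹) := by
    simp only [Function.comp_def] at m
    fun_prop
  refine lt_of_lt_of_le ?_ (le_iSup _ (0 : ℝ))
  refine lintegral_pos_of_forall_pos ?_ fun y => lintegral_pos_of_forall_pos ?_ fun z => ?_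
  · exact Measurable.lintegral_prod_right' (f := fun p : ℝ × ℝ =>
      ENNReal.ofReal ((F !₂[0, p.1, p.2] ^ 2)⁻¹)) (m1.comp (f := fun p : ℝ × ℝ => ((0 : ℝ), p))
        (by fun_prop))
  · exact m1.comp (f := fun z : ℝ => ((0 : ℝ), y, z)) (by fun_prop)
  · rw [ENNReal.ofReal_pos]
    have := h !₂[0, y, z]
    positivity

lemma planeSup_ne_top {F : E3 → ℝ} {c : ℝ} (hc : 0 < c) (hF : ∀ x, c * (1 + ‖x‖ ^ 2) ≤ F x) :
    planeSup F ≠ ∞ := by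
  refine ne_top_of_le_ne_top (b := ENNReal.ofReal ((c ^ 2)⁻¹ * Real.pi) * ENNReal.ofReal Real.pi)
    (by finiteness) (iSup_le fun x => ?_)
  refine lintegral_lintegral_inv_sq_le (x := x) hc fun y z => ?_
  have := hF !₂[x, y, z]
  rw [norm_sq_vec] at this
  convert this using 2; ring

lemma planeSup_const_mul (F : E3 → ℝ) (c : ℝ) :
    planeSup (fun x => c * F x) = ENNReal.ofReal ((c ^ 2)⁻¹) * planeSup F := by
  have h0 : ENNReal.ofReal ((c ^ 2)⁻¹) ≠ ∞ := ENNReal.ofReal_ne_top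
  unfold planeSup
  rw [ENNReal.mul_iSup]
  congr 1; ext x
  rw [← lintegral_const_mul' _ _ h0]
  congr 1; ext y
  rw [← lintegral_const_mul' _ _ h0]
  congr 1; ext z
  rw [← ENNReal.ofReal_mul (by positivity), mul_pow, mul_inv]

lemma exists_planeSup_eq {g h : E3 → ℝ} (hg : Measurable g) (hh : Measurable h) {c : ℝ}
    (hc : 0 < c) (hgc : ∀ x, c * (1 + ‖x‖ ^ 2) ≤ g x) (hhc : ∀ x, c * (1 + ‖x‖ ^ 2) ≤ h x) :
    ∃ r : ℝ, 0 < r ∧ planeSup g = planeSup (fun x => r * h x) := by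
  have p (F : E3 → ℝ) (hF : ∀ x, c * (1 + ‖x‖ ^ 2) ≤ F x) (x : E3) : 0 < F x :=
    lt_of_lt_of_le (by positivity) (hF x)
  have g1 := ENNReal.toReal_pos (planeSup_pos hg (p g hgc)).ne' (planeSup_ne_top hc hgc)
  have h1 := ENNReal.toReal_pos (planeSup_pos hh (p h hhc)).ne' (planeSup_ne_top hc hhc)
  refine ⟨√((planeSup h).toReal / (planeSup g).toReal), by positivity, ?_⟩
  rw [planeSup_const_mul, Real.sq_sqrt (by positivity), inv_div,
    ENNReal.ofReal_div_of_pos h1, ENNReal.ofReal_toReal (planeSup_ne_top hc hgc),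
    ENNReal.ofReal_toReal (planeSup_ne_top hc hhc), ENNReal.div_mul_cancel
    (planeSup_pos hh (p h hhc)).ne' (planeSup_ne_top hc hhc)]

lemma integrable_inv_one_add_norm_sq_sq : Integrable fun x : E3 => ((1 + ‖x‖ ^ 2) ^ 2)⁻¹ := by
  have := integrable_rpow_neg_one_add_norm_sq (E := E3) (μ := volume) (r := 4) (by simp; norm_num)
  refine this.congr (Filter.Eventually.of_forall fun x => ?_)
  simp only
  rw [show (-4 / 2 : ℝ) = -((2 : ℕ) : ℝ) by norm_num, Real.rpow_neg (by positivity),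
    Real.rpow_natCast]

lemma integrable_of_abs_le {F : E3 → ℝ} (hF : Continuous F) {C : ℝ}
    (h : ∀ x, |F x| ≤ C * ((1 + ‖x‖ ^ 2) ^ 2)⁻¹) : Integrable F :=
  (integrable_inv_one_add_norm_sq_sq.const_mul C).mono' hF.aestronglyMeasurable
    (Filter.Eventually.of_forall h)

/-- First-order expansion of a compactly supported `C¹` function, uniform in the base point. -/
lemma exists_taylor_lower_bound {G : E3 → ℝ} (hG : ContDiff ℝ 1 G) (hGc : HasCompactSupport G)
    {η : ℝ} (hη : 0 < η) :
    ∃ L, 0 ≤ L ∧ ∀ x y, G x + fderiv ℝ G x y - η * ‖y‖ - L * ‖y‖ ^ 2 ≤ G (x + y) := by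
  have hcont : Continuous (fderiv ℝ G) := hG.continuous_fderiv one_ne_zero
  have hcs : HasCompactSupport (fderiv ℝ G) := hGc.fderiv ℝ
  obtain ⟨M, hM⟩ := hcont.bounded_above_of_compact_support hcs
  have huc : UniformContinuous (fderiv ℝ G) := hcs.uniformContinuous_of_continuous hcont
  obtain ⟨δ, hδ, hδ'⟩ := Metric.uniformContinuous_iff.mp huc η hη
  have hM0 : 0 ≤ M := (norm_nonneg _).trans (hM 0)
  have hdiff := hG.differentiable one_ne_zero
  refine ⟨2 * M / δ, by positivity, fun x y => ?_⟩
  by_cases hy : ‖y‖ < δ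
  · have key := (convex_ball x δ).norm_image_sub_le_of_norm_hasFDerivWithin_le' (f := G)
      (f' := fderiv ℝ G) (φ := fderiv ℝ G x) (C := η)
      (fun z _ => (hdiff z).hasFDerivAt.hasFDerivWithinAt)
      (fun z hz => by rw [← dist_eq_norm]; exact (hδ' hz).le) (Metric.mem_ball_self hδ)
      (y := x + y) (by simpa using hy)
    rw [add_sub_cancel_left, Real.norm_eq_abs, abs_le] at key
    have : 0 ≤ 2 * M / δ * ‖y‖ ^ 2 := by positivity
    linarith [key.1]
  · push Not at hy
    have key := (convex_univ).norm_image_sub_le_of_norm_fderiv_le (f := G) (C := M)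
      (fun z _ => hdiff z) (fun z _ => hM z) (Set.mem_univ x) (Set.mem_univ (x + y))
    rw [add_sub_cancel_left, Real.norm_eq_abs, abs_le] at key
    have h1 : fderiv ℝ G x y ≤ M * ‖y‖ := (le_abs_self _).trans
      (((fderiv ℝ G x).le_opNorm y).trans (by gcongr; exact hM x))
    have h2 : 2 * M * ‖y‖ ≤ 2 * M / δ * ‖y‖ ^ 2 := by
      rw [div_mul_eq_mul_div, le_div_iff₀ hδ]
      nlinarith [mul_nonneg hM0 (norm_nonneg y)]
    have : 0 ≤ η * ‖y‖ := by positivity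
    linarith [key.1]

lemma inv_sub_sq_le {g p t C : ℝ} (hg : 0 < g) (hp : |p| ≤ C * g) (ht : 0 < t)
    (htC : t * C ≤ 1 / 2) :
    ((g - t * p) ^ 2)⁻¹ ≤ (g ^ 2)⁻¹ + t * (2 * (p * (g ^ 3)⁻¹)) + t ^ 2 * (16 * C ^ 2 * (g ^ 2)⁻¹) := by
  have hC : 0 ≤ C := by
    by_contra! h
    nlinarith [abs_nonneg p, mul_neg_of_neg_of_pos h hg]
  set s := t * p / g with hs
  have hp' : p = s * g / t := by rw [hs]; field_simp
  have hsC : |s| ≤ t * C := by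
    rw [hs, abs_div, abs_mul, abs_of_pos ht, abs_of_pos hg, div_le_iff₀ hg]
    nlinarith
  have hs1 := abs_le.mp (hsC.trans htC)
  have h1s : 1 / 2 ≤ 1 - s := by linarith [hs1.2]
  have e1 : ((g - t * p) ^ 2)⁻¹ = ((1 - s) ^ 2)⁻¹ * (g ^ 2)⁻¹ := by
    rw [← mul_inv, ← mul_pow, hp']
    congr 2; field_simp
  have e2 : t * (2 * (p * (g ^ 3)⁻¹)) = 2 * s * (g ^ 2)⁻¹ := by
    rw [hs]; field_simp
  rw [e1, e2]
  have e3 : ((1 - s) ^ 2)⁻¹ ≤ 1 + 2 * s + 16 * s ^ 2 := by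
    rw [inv_le_iff_one_le_mul₀ (by positivity)]
    have h4 : 1 / 4 ≤ (1 - s) ^ 2 := by nlinarith
    nlinarith [mul_nonneg (sq_nonneg s) (by linarith [hs1.1] : 0 ≤ 1 + 2 * s),
      mul_nonneg (sq_nonneg s) (sub_nonneg.mpr h4),
      mul_nonneg (sq_nonneg s) (by linarith [hs1.2] : 0 ≤ 1 - 2 * s)]
  have e4 : s ^ 2 ≤ t ^ 2 * C ^ 2 := by
    rw [← mul_pow, ← sq_abs s]
    gcongr
  have e5 : 0 ≤ (g ^ 2)⁻¹ := by positivity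
  nlinarith [mul_le_mul_of_nonneg_right e3 e5, mul_le_mul_of_nonneg_right e4 e5]

lemma inv_sq_le_of_le {c g r : ℝ} (hc : 0 < c) (hr : 0 < r) (h : c * r ≤ g) :
    (g ^ 2)⁻¹ ≤ (c ^ 2)⁻¹ * (r ^ 2)⁻¹ := by
  rw [← mul_inv, ← mul_pow]
  gcongr

/-- Infinitesimal form of the Borell–Brascamp–Lieb inequality. -/
lemma integral_inv_sq_le_of_hamiltonJacobi {g h p : E3 → ℝ} (hg : Continuous g)
    (hh : Continuous h) (hp : Continuous p) {c C t₀ : ℝ} (hc : 0 < c)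
    (hgc : ∀ x, c * (1 + ‖x‖ ^ 2) ≤ g x) (hhc : ∀ x, c * (1 + ‖x‖ ^ 2) ≤ h x)
    (hpC : ∀ x, |p x| ≤ C * g x) (ht₀ : 0 < t₀)
    (hgh : ∀ t, 0 < t → t ≤ t₀ → ∀ x y, g (x + t • y) - t * p (x + t • y) ≤ g x + t * h y)
    (hmarg : planeSup g = planeSup h) :
    ∫ x, (h x ^ 2)⁻¹ ≤ 2 * ∫ x, p x * (g x ^ 3)⁻¹ := by
  have pos : ∀ F : E3 → ℝ, (∀ x, c * (1 + ‖x‖ ^ 2) ≤ F x) → ∀ x, 0 < F x := fun F hF x =>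
    lt_of_lt_of_le (by positivity) (hF x)
  have hg0 := pos g hgc
  have hh0 := pos h hhc
  have hgne : ∀ x, g x ≠ 0 := fun x => (hg0 x).ne'
  have hhne : ∀ x, h x ≠ 0 := fun x => (hh0 x).ne'
  have hC : 0 ≤ C := by
    by_contra! hneg
    have := hpC 0
    nlinarith [abs_nonneg (p 0), mul_neg_of_neg_of_pos hneg (hg0 0)]
  have int2 : ∀ F : E3 → ℝ, Continuous F → (∀ x, c * (1 + ‖x‖ ^ 2) ≤ F x) →
      Integrable fun x => (F x ^ 2)⁻¹ := by
    intro F hF hFc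
    refine integrable_of_abs_le (C := (c ^ 2)⁻¹)
      ((hF.pow 2).inv₀ fun x => pow_ne_zero _ (pos F hFc x).ne') fun x => ?_
    rw [abs_of_nonneg (by positivity)]
    exact inv_sq_le_of_le hc (by positivity) (hFc x)
  have intp : Integrable fun x => p x * (g x ^ 3)⁻¹ := by
    refine integrable_of_abs_le (C := C * (c ^ 2)⁻¹)
      (hp.mul ((hg.pow 3).inv₀ fun x => pow_ne_zero _ (hgne x))) fun x => ?_
    rw [abs_mul, abs_of_nonneg (a := (g x ^ 3)⁻¹) (by have := hg0 x; positivity), mul_assoc]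
    calc |p x| * (g x ^ 3)⁻¹ ≤ C * g x * (g x ^ 3)⁻¹ := by
          have := hg0 x
          gcongr; exact hpC x
      _ = C * (g x ^ 2)⁻¹ := by have := hgne x; field_simp
      _ ≤ _ := by gcongr; exact inv_sq_le_of_le hc (by positivity) (hgc x)
  have key : ∀ t, 0 < t → t ≤ t₀ → t * C ≤ 1 / 2 →
      ∫ x, (h x ^ 2)⁻¹ ≤ 2 * (∫ x, p x * (g x ^ 3)⁻¹) + t * (16 * C ^ 2 * ∫ x, (g x ^ 2)⁻¹) := by
    intro t ht htt htC
    have hw2 : ∀ x, c / 2 * (1 + ‖x‖ ^ 2) ≤ g x - t * p x := by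
      intro x
      have h1 := (abs_le.mp (hpC x)).2
      have h2 : t * p x ≤ 1 / 2 * g x := by
        calc t * p x ≤ t * (C * g x) := by gcongr
          _ = t * C * g x := by ring
          _ ≤ _ := by have := (hg0 x).le; gcongr
      linarith [hgc x]
    have hw0 : ∀ x, 0 < g x - t * p x := fun x => lt_of_lt_of_le (by positivity) (hw2 x)
    have bbl := lintegral_inv_sq_add_le_E3 hg.measurable hh.measurable
      (w := fun x => g x - t * p x) (by fun_prop) hc hgc hhc hw0 ht (hgh t ht htt) hmarg
    have intw : Integrable fun x => ((g x - t * p x) ^ 2)⁻¹ := by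
      refine integrable_of_abs_le (C := ((c / 2) ^ 2)⁻¹)
        (((hg.sub (continuous_const.mul hp)).pow 2).inv₀ fun x => pow_ne_zero _ (hw0 x).ne') fun x => ?_
      rw [abs_of_nonneg (by positivity)]
      exact inv_sq_le_of_le (by positivity) (by positivity) (hw2 x)
    have nn : ∀ F : E3 → ℝ, 0 ≤ᵐ[volume] fun x => (F x ^ 2)⁻¹ := fun F =>
      Filter.Eventually.of_forall fun x => by positivity
    rw [← ofReal_integral_eq_lintegral_ofReal (int2 g hg hgc) (nn g),
      ← ofReal_integral_eq_lintegral_ofReal (int2 h hh hhc) (nn h),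
      ← ofReal_integral_eq_lintegral_ofReal intw (nn _), ← ENNReal.ofReal_mul ht.le,
      ← ENNReal.ofReal_add (by positivity) (by positivity),
      ENNReal.ofReal_le_ofReal_iff (by positivity)] at bbl
    have int1 : Integrable fun x => (g x ^ 2)⁻¹ + t * (2 * (p x * (g x ^ 3)⁻¹)) :=
      (int2 g hg hgc).add ((intp.const_mul 2).const_mul t)
    have up : ∫ x, ((g x - t * p x) ^ 2)⁻¹ ≤ ∫ x, ((g x ^ 2)⁻¹ + t * (2 * (p x * (g x ^ 3)⁻¹)) +
        t ^ 2 * (16 * C ^ 2 * (g x ^ 2)⁻¹)) := by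
      refine integral_mono intw ?_ fun x => inv_sub_sq_le (hg0 x) (hpC x) ht htC
      exact int1.add (((int2 g hg hgc).const_mul _).const_mul _)
    rw [integral_add int1 (((int2 g hg hgc).const_mul _).const_mul _),
      integral_add (int2 g hg hgc) ((intp.const_mul 2).const_mul t)] at up
    simp only [integral_const_mul] at up
    have : t * ∫ x, (h x ^ 2)⁻¹ ≤
        t * (2 * (∫ x, p x * (g x ^ 3)⁻¹) + t * (16 * C ^ 2 * ∫ x, (g x ^ 2)⁻¹)) := by
      linarith
    exact le_of_mul_le_mul_left this ht
  have lim : Filter.Tendsto (fun t : ℝ => 2 * (∫ x, p x * (g x ^ 3)⁻¹) +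
      t * (16 * C ^ 2 * ∫ x, (g x ^ 2)⁻¹)) (nhdsWithin 0 (Set.Ioi 0))
      (nhds (2 * (∫ x, p x * (g x ^ 3)⁻¹) + 0 * (16 * C ^ 2 * ∫ x, (g x ^ 2)⁻¹))) :=
    (Continuous.tendsto (by fun_prop) _).mono_left nhdsWithin_le_nhds
  rw [zero_mul, add_zero] at lim
  refine ge_of_tendsto lim ?_
  have hsmall : 0 < min t₀ (1 / (2 * (C + 1))) := by positivity
  filter_upwards [Ioc_mem_nhdsGT hsmall] with t ht
  refine key t ht.1 (ht.2.trans (min_le_left _ _)) ?_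
  have h2 : t ≤ 1 / (2 * (C + 1)) := ht.2.trans (min_le_right _ _)
  rw [le_div_iff₀ (by positivity)] at h2
  nlinarith [ht.1]

lemma fderiv_quadratic_add {g G : E3 → ℝ} {k : ℝ} (hG : ContDiff ℝ 1 G)
    (hg : ∀ x, g x = k * (1 + ‖x‖ ^ 2) + G x) (z v : E3) :
    fderiv ℝ g z v = k * (2 * inner ℝ z v) + fderiv ℝ G z v := by
  have h1 : HasFDerivAt (fun x : E3 => k * (1 + ‖x‖ ^ 2)) (k • ((2 : ℕ) • innerSL ℝ z)) z := by
    have := ((hasStrictFDerivAt_norm_sq z).hasFDerivAt.const_add 1).const_mul k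
    simpa using this
  have h2 := h1.add (hG.differentiable one_ne_zero z).hasFDerivAt
  have h3 : g = (fun x => k * (1 + ‖x‖ ^ 2)) + G := funext hg
  rw [h3, h2.fderiv]
  simp

lemma contDiff_quadratic_add {g G : E3 → ℝ} {k : ℝ} (hG : ContDiff ℝ 1 G)
    (hg : ∀ x, g x = k * (1 + ‖x‖ ^ 2) + G x) : ContDiff ℝ 1 g := by
  have h3 : g = fun x => k * (1 + ‖x‖ ^ 2) + G x := funext hg
  rw [h3]
  exact (contDiff_const.mul (contDiff_const.add (contDiff_norm_sq ℝ))).add hG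

/-- The Hamilton–Jacobi comparison for a compactly supported `C¹` perturbation of a quadratic. -/
lemma exists_hamiltonJacobi_bound {g G : E3 → ℝ} {k : ℝ} (hk : 0 < k) (hG : ContDiff ℝ 1 G)
    (hGc : HasCompactSupport G) (hg : ∀ x, g x = k * (1 + ‖x‖ ^ 2) + G x) {c η : ℝ} (hη : 0 < η)
    (hηc : η < c / 12) :
    ∃ t₀, 0 < t₀ ∧ ∀ t, 0 < t → t ≤ t₀ → ∀ x y, g (x + t • y) -
      t * (‖fderiv ℝ g (x + t • y)‖ ^ 2 / (4 * (c / 3 - 2 * η)) - (c - η)) ≤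
        g x + t * (c * (1 + ‖y‖ ^ 2 / 3)) := by
  obtain ⟨L, hL0, hL⟩ := exists_taylor_lower_bound hG hGc hη
  refine ⟨η / (L + 1), by positivity, fun t ht htt x y => ?_⟩
  have hLt : L * t ≤ η := by
    rw [le_div_iff₀ (by positivity)] at htt
    nlinarith
  set z := x + t • y with hz
  have hx : x = z + -(t • y) := by rw [hz]; abel
  have taylor := hL z (-(t • y))
  rw [← hx, norm_neg, norm_smul, Real.norm_eq_abs, abs_of_pos ht, map_neg, map_smul,
    smul_eq_mul] at taylor
  have quad : ‖x‖ ^ 2 = ‖z‖ ^ 2 - 2 * (t * inner ℝ z y) + t ^ 2 * ‖y‖ ^ 2 := by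
    rw [hx, ← sub_eq_add_neg, norm_sub_sq_real, inner_smul_right, norm_smul, mul_pow]
    simp
  have hD : fderiv ℝ g z y ≤ ‖fderiv ℝ g z‖ * ‖y‖ :=
    (le_abs_self _).trans ((fderiv ℝ g z).le_opNorm y)
  have hgx : g z - t * fderiv ℝ g z y - t * (η * ‖y‖) - t * (η * ‖y‖ ^ 2) ≤ g x := by
    rw [hg x, hg z, fderiv_quadratic_add hG hg, quad]
    have h1 : 0 ≤ k * (t ^ 2 * ‖y‖ ^ 2) := by positivity
    have h2 : L * t * (t * ‖y‖ ^ 2) ≤ η * (t * ‖y‖ ^ 2) := by gcongr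
    nlinarith
  set κ := c / 3 - 2 * η with hκ
  have hκ0 : 0 < κ := by rw [hκ]; linarith
  set N := ‖fderiv ℝ g z‖
  have hN : N * ‖y‖ ≤ N ^ 2 / (4 * κ) + κ * ‖y‖ ^ 2 := by
    have : N ^ 2 / (4 * κ) + κ * ‖y‖ ^ 2 - N * ‖y‖ = (N - 2 * κ * ‖y‖) ^ 2 / (4 * κ) := by
      field_simp; ring
    have h2 : 0 ≤ (N - 2 * κ * ‖y‖) ^ 2 / (4 * κ) := by positivity
    linarith
  have hy : η * ‖y‖ ≤ η * (1 + ‖y‖ ^ 2) := by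
    gcongr
    nlinarith [sq_nonneg (‖y‖ - 1)]
  have hfin : fderiv ℝ g z y + η * ‖y‖ + η * ‖y‖ ^ 2 ≤
      N ^ 2 / (4 * κ) - (c - η) + c * (1 + ‖y‖ ^ 2 / 3) := by
    have : κ * ‖y‖ ^ 2 = c / 3 * ‖y‖ ^ 2 - 2 * η * ‖y‖ ^ 2 := by rw [hκ]; ring
    nlinarith
  have := mul_le_mul_of_nonneg_left hfin ht.le
  linarith

/-- Dual form of the sharp Sobolev inequality, for `g = f⁻²`. -/
lemma exists_dual_sobolev {g G : E3 → ℝ} {k c₀ : ℝ} (hk : 0 < k) (hc₀ : 0 < c₀)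
    (hG : ContDiff ℝ 1 G) (hGc : HasCompactSupport G) (hg : ∀ x, g x = k * (1 + ‖x‖ ^ 2) + G x)
    (hgc : ∀ x, c₀ * (1 + ‖x‖ ^ 2) ≤ g x) :
    ∃ r : ℝ, 0 < r ∧ Integrable (fun x => ‖fderiv ℝ g x‖ ^ 2 * (g x ^ 3)⁻¹) ∧
      Integrable (fun x => (g x ^ 3)⁻¹) ∧
      (r ^ 2)⁻¹ * ∫ x : E3, ((1 + ‖x‖ ^ 2 / 3) ^ 2)⁻¹ ≤
        3 / (2 * r) * (∫ x, ‖fderiv ℝ g x‖ ^ 2 * (g x ^ 3)⁻¹) - 2 * r * ∫ x, (g x ^ 3)⁻¹ := by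
  have hg1 : ContDiff ℝ 1 g := contDiff_quadratic_add hG hg
  have hgcont := hg1.continuous
  have hDcont := hg1.continuous_fderiv one_ne_zero
  have hg0 : ∀ x, 0 < g x := fun x => lt_of_lt_of_le (by positivity) (hgc x)
  have hgne : ∀ x, g x ≠ 0 := fun x => (hg0 x).ne'
  obtain ⟨M, hM⟩ := (hG.continuous_fderiv one_ne_zero).bounded_above_of_compact_support
    (hGc.fderiv ℝ)
  have hM0 : 0 ≤ M := (norm_nonneg _).trans (hM 0)
  obtain ⟨C₁, hC₁0, hC₁⟩ : ∃ C₁, 0 ≤ C₁ ∧ ∀ x, ‖fderiv ℝ g x‖ ^ 2 ≤ C₁ * g x := by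
    refine ⟨(8 * k ^ 2 + 2 * M ^ 2) / c₀, by positivity, fun x => ?_⟩
    have h1 : ‖fderiv ℝ g x‖ ≤ 2 * k * ‖x‖ + M := by
      refine ContinuousLinearMap.opNorm_le_bound _ (by positivity) fun v => ?_
      rw [fderiv_quadratic_add hG hg]
      have e1 : ‖inner ℝ x v‖ ≤ ‖x‖ * ‖v‖ := norm_inner_le_norm x v
      have e2 : ‖fderiv ℝ G x v‖ ≤ M * ‖v‖ :=
        ((fderiv ℝ G x).le_opNorm v).trans (by gcongr; exact hM x)
      calc _ ≤ ‖k * (2 * inner ℝ x v)‖ + ‖fderiv ℝ G x v‖ := norm_add_le _ _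
        _ = k * (2 * ‖inner ℝ x v‖) + ‖fderiv ℝ G x v‖ := by
          rw [norm_mul, norm_mul, Real.norm_of_nonneg hk.le, Real.norm_two]
        _ ≤ k * (2 * (‖x‖ * ‖v‖)) + M * ‖v‖ := by gcongr
        _ = _ := by ring
    calc ‖fderiv ℝ g x‖ ^ 2 ≤ (2 * k * ‖x‖ + M) ^ 2 := by gcongr
      _ ≤ (8 * k ^ 2 + 2 * M ^ 2) * (1 + ‖x‖ ^ 2) := by
        nlinarith [sq_nonneg (2 * k * ‖x‖ - M), mul_nonneg (sq_nonneg M) (sq_nonneg ‖x‖),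
          sq_nonneg k]
      _ = (8 * k ^ 2 + 2 * M ^ 2) / c₀ * (c₀ * (1 + ‖x‖ ^ 2)) := by field_simp
      _ ≤ _ := by gcongr; exact hgc x
  have hcube : Continuous fun x => (g x ^ 3)⁻¹ :=
    (hgcont.pow 3).inv₀ fun x => pow_ne_zero _ (hgne x)
  have hcube_le : ∀ x, g x * (g x ^ 3)⁻¹ ≤ (c₀ ^ 2)⁻¹ * ((1 + ‖x‖ ^ 2) ^ 2)⁻¹ := by
    intro x
    have e : g x * (g x ^ 3)⁻¹ = (g x ^ 2)⁻¹ := by have := hgne x; field_simp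
    rw [e]
    exact inv_sq_le_of_le hc₀ (by positivity) (hgc x)
  have hc₀g : ∀ x, c₀ ≤ g x := fun x =>
    le_trans (by nlinarith [sq_nonneg ‖x‖]) (hgc x)
  have intX : Integrable fun x => ‖fderiv ℝ g x‖ ^ 2 * (g x ^ 3)⁻¹ := by
    refine integrable_of_abs_le (C := C₁ * (c₀ ^ 2)⁻¹) ((hDcont.norm.pow 2).mul hcube) fun x => ?_
    have h0 := hg0 x
    rw [abs_of_nonneg (by positivity), mul_assoc]
    calc _ ≤ C₁ * g x * (g x ^ 3)⁻¹ := by gcongr; exact hC₁ x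
      _ = C₁ * (g x * (g x ^ 3)⁻¹) := by ring
      _ ≤ _ := mul_le_mul_of_nonneg_left (hcube_le x) (by positivity)
  have intB : Integrable fun x => (g x ^ 3)⁻¹ := by
    refine integrable_of_abs_le (C := c₀⁻¹ * (c₀ ^ 2)⁻¹) hcube fun x => ?_
    have h0 := hg0 x
    rw [abs_of_nonneg (by positivity), mul_assoc]
    calc (g x ^ 3)⁻¹ = c₀⁻¹ * (c₀ * (g x ^ 3)⁻¹) := by field_simp
      _ ≤ c₀⁻¹ * (g x * (g x ^ 3)⁻¹) := by gcongr; exact hc₀g x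
      _ ≤ _ := mul_le_mul_of_nonneg_left (hcube_le x) (by positivity)
  have hhcont : Continuous fun x : E3 => 1 + ‖x‖ ^ 2 / 3 := by fun_prop
  obtain ⟨r, hr, hmarg⟩ := exists_planeSup_eq (c := min c₀ (1 / 3)) hgcont.measurable
    hhcont.measurable (by positivity)
    (fun x => le_trans (by gcongr; exact min_le_left _ _) (hgc x))
    (fun x => le_trans (mul_le_mul_of_nonneg_right (min_le_right _ _) (by positivity))
      (by linarith))
  refine ⟨r, hr, intX, intB, ?_⟩
  set X := ∫ x, ‖fderiv ℝ g x‖ ^ 2 * (g x ^ 3)⁻¹ with hX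
  set B := ∫ x, (g x ^ 3)⁻¹ with hB
  have key : ∀ η, 0 < η → η < r / 12 → (r ^ 2)⁻¹ * ∫ x : E3, ((1 + ‖x‖ ^ 2 / 3) ^ 2)⁻¹ ≤
      2 * ((4 * (r / 3 - 2 * η))⁻¹ * X - (r - η) * B) := by
    intro η hη hηr
    obtain ⟨t₀, ht₀, hHJ⟩ := exists_hamiltonJacobi_bound hk hG hGc hg hη hηr
    have hκ : 0 < r / 3 - 2 * η := by linarith
    have := integral_inv_sq_le_of_hamiltonJacobi (c := min c₀ (r / 3))
      (C := C₁ / (4 * (r / 3 - 2 * η)) + r / c₀)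
      (p := fun x => ‖fderiv ℝ g x‖ ^ 2 / (4 * (r / 3 - 2 * η)) - (r - η)) hgcont
      (h := fun x => r * (1 + ‖x‖ ^ 2 / 3))
      (by fun_prop) (by fun_prop) (by positivity)
      (fun x => le_trans (by gcongr; exact min_le_left _ _) (hgc x))
      (fun x => le_trans (mul_le_mul_of_nonneg_right (min_le_right _ _) (by positivity))
        (by linarith)) (fun x => by
          have e1 : ‖fderiv ℝ g x‖ ^ 2 / (4 * (r / 3 - 2 * η)) ≤
              C₁ / (4 * (r / 3 - 2 * η)) * g x := by
            rw [div_mul_eq_mul_div]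
            gcongr
            exact hC₁ x
          have e2 : r ≤ r / c₀ * g x := by
            rw [div_mul_eq_mul_div, le_div_iff₀ hc₀]
            gcongr
            exact hc₀g x
          have e3 : 0 ≤ ‖fderiv ℝ g x‖ ^ 2 / (4 * (r / 3 - 2 * η)) := by positivity
          rw [abs_le]
          constructor <;> linarith) ht₀ hHJ hmarg
    have e1 : ∫ x : E3, ((r * (1 + ‖x‖ ^ 2 / 3)) ^ 2)⁻¹ =
        (r ^ 2)⁻¹ * ∫ x : E3, ((1 + ‖x‖ ^ 2 / 3) ^ 2)⁻¹ := by
      rw [← integral_const_mul]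
      congr 1; ext x
      rw [mul_pow, mul_inv]
    have e2 : ∫ x, (‖fderiv ℝ g x‖ ^ 2 / (4 * (r / 3 - 2 * η)) - (r - η)) * (g x ^ 3)⁻¹ =
        (4 * (r / 3 - 2 * η))⁻¹ * X - (r - η) * B := by
      rw [hX, hB, ← integral_const_mul, ← integral_const_mul,
        ← integral_sub (intX.const_mul _) (intB.const_mul _)]
      congr 1; ext x
      ring
    rwa [e1, e2] at this
  have lim : Filter.Tendsto (fun η : ℝ => 2 * ((4 * (r / 3 - 2 * η))⁻¹ * X - (r - η) * B))
      (nhdsWithin 0 (Set.Ioi 0))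
      (nhds (2 * ((4 * (r / 3 - 2 * 0))⁻¹ * X - (r - 0) * B))) := by
    refine Filter.Tendsto.mono_left ?_ nhdsWithin_le_nhds
    refine ContinuousAt.tendsto (f := fun η : ℝ =>
      2 * ((4 * (r / 3 - 2 * η))⁻¹ * X - (r - η) * B)) ?_
    have : (4 * (r / 3 - 2 * 0)) ≠ 0 := by simp [hr.ne']
    fun_prop (disch := assumption)
  have e : 2 * ((4 * (r / 3 - 2 * 0))⁻¹ * X - (r - 0) * B) = 3 / (2 * r) * X - 2 * r * B := by
    have hr' := hr.ne'
    simp only [mul_zero, sub_zero]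
    field_simp
    ring
  rw [e] at lim
  refine ge_of_tendsto lim ?_
  filter_upwards [Ioo_mem_nhdsGT (show 0 < r / 12 by positivity)] with η hη
  exact key η hη.1 hη.2

lemma norm_fderiv_apply_sq_le_gradSqC (f : E3 → ℂ) (x y : E3) :
    ‖fderiv ℝ f x y‖ ^ 2 ≤ gradSqC f x * ‖y‖ ^ 2 := by
  have hy : y = ∑ i, y i • e3 i := by
    ext j
    simp [e3, Fin.sum_univ_three]
    fin_cases j <;> simp
  have h1 : ‖fderiv ℝ f x y‖ ≤ ∑ i, ‖pdC i f x‖ * ‖y i‖ := by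
    conv_lhs => rw [hy, map_sum]
    refine (norm_sum_le _ _).trans (Finset.sum_le_sum fun i _ => ?_)
    rw [map_smul, norm_smul, mul_comm]
    rfl
  calc ‖fderiv ℝ f x y‖ ^ 2 ≤ (∑ i, ‖pdC i f x‖ * ‖y i‖) ^ 2 := by gcongr
    _ ≤ (∑ i, ‖pdC i f x‖ ^ 2) * ∑ i, ‖y i‖ ^ 2 := Finset.sum_mul_sq_le_sq_mul_sq _ _ _
    _ = _ := by rw [EuclideanSpace.norm_sq_eq]; rfl

lemma gradSqC_nonneg (f : E3 → ℂ) (x : E3) : 0 ≤ gradSqC f x :=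
  Finset.sum_nonneg fun _ _ => by positivity

lemma continuous_gradSqC {f : E3 → ℂ} (hf : ContDiff ℝ 1 f) : Continuous (gradSqC f) := by
  have := hf.continuous_fderiv one_ne_zero
  unfold gradSqC pdC
  fun_prop

lemma hasFDerivAt_inv_one_add_norm_sq (x : E3) :
    HasFDerivAt (fun x : E3 => (1 + ‖x‖ ^ 2)⁻¹)
      (-((1 + ‖x‖ ^ 2) ^ 2)⁻¹ • (2 • innerSL ℝ x)) x := by
  have h1 : HasFDerivAt (fun x : E3 => 1 + ‖x‖ ^ 2) (2 • innerSL ℝ x) x :=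
    (hasStrictFDerivAt_norm_sq x).hasFDerivAt.const_add 1
  exact (hasDerivAt_inv (show 1 + ‖x‖ ^ 2 ≠ 0 by positivity)).comp_hasFDerivAt x h1

lemma norm_fderiv_norm_sq_add_le {f : E3 → ℂ} (hf : ContDiff ℝ 1 f) {δ : ℝ} (x : E3) :
    ‖fderiv ℝ (fun x => ‖f x‖ ^ 2 + δ ^ 2 * (1 + ‖x‖ ^ 2)⁻¹) x‖ ^ 2 ≤
      4 * (‖f x‖ ^ 2 + δ ^ 2 * (1 + ‖x‖ ^ 2)⁻¹) *
        (gradSqC f x + δ ^ 2 * ((1 + ‖x‖ ^ 2) ^ 2)⁻¹) := by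
  have hfd := (hf.differentiable one_ne_zero x).hasFDerivAt
  have hd : HasFDerivAt (fun x => ‖f x‖ ^ 2 + δ ^ 2 * (1 + ‖x‖ ^ 2)⁻¹) _ x :=
    hfd.norm_sq.add ((hasFDerivAt_inv_one_add_norm_sq x).const_mul (δ ^ 2))
  rw [hd.fderiv]
  have hA := gradSqC_nonneg f x
  rw [← Real.le_sqrt (norm_nonneg _) (by positivity)]
  refine ContinuousLinearMap.opNorm_le_bound _ (Real.sqrt_nonneg _) fun y => ?_
  rw [← Real.sqrt_sq (norm_nonneg y), ← Real.sqrt_mul (by positivity)]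
  apply Real.le_sqrt_of_sq_le
  have hq := norm_fderiv_apply_sq_le_gradSqC f x y
  set θ := (1 + ‖x‖ ^ 2)⁻¹ with hθ
  have hθ0 : 0 < θ := by positivity
  have hθ1 : θ * (1 + ‖x‖ ^ 2) = 1 := inv_mul_cancel₀ (by positivity)
  have hθ2 : ((1 + ‖x‖ ^ 2) ^ 2)⁻¹ = θ ^ 2 := by rw [hθ, inv_pow]
  rw [hθ2]
  set q := ‖fderiv ℝ f x y‖ with hq'
  have h1 : |inner ℝ (f x) (fderiv ℝ f x y)| ≤ ‖f x‖ * q := abs_real_inner_le_norm _ _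
  have h2 : |inner ℝ x y| ≤ ‖x‖ * ‖y‖ := abs_real_inner_le_norm _ _
  have h3 : ‖2 * inner ℝ (f x) (fderiv ℝ f x y) + δ ^ 2 * (-θ ^ 2 * (2 * inner ℝ x y))‖ ≤
      2 * (‖f x‖ * q + δ ^ 2 * θ ^ 2 * (‖x‖ * ‖y‖)) := by
    refine (norm_add_le _ _).trans ?_
    simp only [norm_mul, norm_neg, norm_pow, Real.norm_eq_abs, sq_abs, abs_of_pos hθ0, abs_two]
    nlinarith [mul_le_mul_of_nonneg_left h2 (show 0 ≤ δ ^ 2 * θ ^ 2 by positivity)]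
  have h4 : (‖f x‖ * q + δ ^ 2 * θ ^ 2 * (‖x‖ * ‖y‖)) ^ 2 ≤
      (‖f x‖ ^ 2 + δ ^ 2 * θ) * (q ^ 2 + δ ^ 2 * (θ ^ 3 * ‖x‖ ^ 2) * ‖y‖ ^ 2) := by
    have : 0 ≤ δ ^ 2 * θ * (‖f x‖ * θ * ‖x‖ * ‖y‖ - q) ^ 2 := by positivity
    linarith
  have h5 : θ ^ 3 * ‖x‖ ^ 2 ≤ θ ^ 2 := by
    have : θ ^ 2 * (θ * (1 + ‖x‖ ^ 2)) = θ ^ 2 := by rw [hθ1, mul_one]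
    nlinarith [pow_pos hθ0 3]
  have h6 : ‖((2 • (innerSL ℝ (f x)).comp (fderiv ℝ f x) +
      δ ^ 2 • (-θ ^ 2 • (2 • innerSL ℝ x))) y : ℝ)‖ =
      ‖2 * inner ℝ (f x) (fderiv ℝ f x y) + δ ^ 2 * (-θ ^ 2 * (2 * inner ℝ x y))‖ := by
    simp [mul_add]
  rw [h6]
  calc _ ≤ (2 * (‖f x‖ * q + δ ^ 2 * θ ^ 2 * (‖x‖ * ‖y‖))) ^ 2 := by gcongr
    _ = 4 * (‖f x‖ * q + δ ^ 2 * θ ^ 2 * (‖x‖ * ‖y‖)) ^ 2 := by ring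
    _ ≤ 4 * ((‖f x‖ ^ 2 + δ ^ 2 * θ) * (q ^ 2 + δ ^ 2 * (θ ^ 3 * ‖x‖ ^ 2) * ‖y‖ ^ 2)) := by
      gcongr
    _ ≤ 4 * ((‖f x‖ ^ 2 + δ ^ 2 * θ) * (gradSqC f x * ‖y‖ ^ 2 + δ ^ 2 * θ ^ 2 * ‖y‖ ^ 2)) := by
      gcongr
    _ = _ := by ring

lemma mul_sq_le_of_forall_amgm {A B D r : ℝ} (hr : 0 < r) (hB : 0 ≤ B) (hD : 0 ≤ D)
    (h : (r ^ 2)⁻¹ * D ≤ 3 / (2 * r) * (4 * A) - 2 * r * B) : B * D ^ 2 ≤ 16 * A ^ 3 := by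
  have h1 : D + 2 * r ^ 3 * B ≤ 6 * r * A := by
    have := mul_le_mul_of_nonneg_left h (show 0 ≤ r ^ 2 by positivity)
    have e1 : r ^ 2 * ((r ^ 2)⁻¹ * D) = D := by field_simp
    have e2 : r ^ 2 * (3 / (2 * r) * (4 * A) - 2 * r * B) = 6 * r * A - 2 * r ^ 3 * B := by
      field_simp; ring
    linarith
  set b := r ^ 3 * B with hb
  have hb0 : 0 ≤ b := by positivity
  have h2 : (D + 2 * b) ^ 3 ≤ (6 * r * A) ^ 3 :=
    pow_le_pow_left₀ (by positivity) (by linarith) 3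
  have h3 : 27 * (2 * b) * (D / 2) ^ 2 * 1 ≤ (2 * b + D) ^ 3 := by
    have : 0 ≤ (2 * b - D / 2) ^ 2 * (2 * b + 4 * D) := by positivity
    nlinarith
  have h4 : r ^ 3 * (B * D ^ 2) ≤ r ^ 3 * (16 * A ^ 3) := by nlinarith
  exact le_of_mul_le_mul_left h4 (by positivity)

/-- Sharp Sobolev inequality with a regularization parameter. -/
lemma sobolev_regularized {f : E3 → ℂ} (hf : ContDiff ℝ 1 f) (hfc : HasCompactSupport f)
    {δ : ℝ} (hδ : 0 < δ) :
    (∫ x, ‖f x‖ ^ 6) * (∫ x : E3, ((1 + ‖x‖ ^ 2 / 3) ^ 2)⁻¹) ^ 2 ≤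
      16 * ((∫ x, gradSqC f x) + δ ^ 2 * ∫ x : E3, ((1 + ‖x‖ ^ 2) ^ 2)⁻¹) ^ 3 := by
  set ρ : E3 → ℝ := fun x => ‖f x‖ ^ 2 + δ ^ 2 * (1 + ‖x‖ ^ 2)⁻¹ with hρ
  have hρ0 : ∀ x, 0 < ρ x := fun x => by simp only [hρ]; positivity
  have hρ1 : ContDiff ℝ 1 ρ := by
    refine (hf.norm_sq ℝ).add (contDiff_const.mul (ContDiff.inv ?_ fun x => by positivity))
    exact contDiff_const.add (contDiff_norm_sq ℝ)
  set g : E3 → ℝ := fun x => (ρ x)⁻¹ with hg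
  have hg1 : ContDiff ℝ 1 g := hρ1.inv fun x => (hρ0 x).ne'
  set k : ℝ := (δ ^ 2)⁻¹ with hk
  set G : E3 → ℝ := fun x => g x - k * (1 + ‖x‖ ^ 2) with hG
  have hG1 : ContDiff ℝ 1 G :=
    hg1.sub (contDiff_const.mul (contDiff_const.add (contDiff_norm_sq ℝ)))
  have hGc : HasCompactSupport G := by
    refine hfc.mono fun x hx => ?_
    contrapose! hx
    have hx' : f x = 0 := by simpa using hx
    simp [hG, hg, hρ, hx', hk, mul_comm]
  obtain ⟨M, hM⟩ : ∃ M, ∀ x, ‖(1 + ‖x‖ ^ 2) * ‖f x‖ ^ 2‖ ≤ M := by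
    have hfcont := hf.continuous
    refine Continuous.bounded_above_of_compact_support (by fun_prop) ?_
    refine hfc.mono fun x hx => ?_
    contrapose! hx
    have hx' : f x = 0 := by simpa using hx
    simp [hx']
  have hM0 : 0 ≤ M := (norm_nonneg _).trans (hM 0)
  have hgc : ∀ x, (M + δ ^ 2)⁻¹ * (1 + ‖x‖ ^ 2) ≤ g x := by
    intro x
    have h1 : (1 + ‖x‖ ^ 2) * ρ x ≤ M + δ ^ 2 := by
      have := (Real.le_norm_self _).trans (hM x)
      have e : (1 + ‖x‖ ^ 2) * ρ x = (1 + ‖x‖ ^ 2) * ‖f x‖ ^ 2 + δ ^ 2 := by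
        simp only [hρ]; field_simp
      linarith
    have := hρ0 x
    simp only [hg]
    rw [inv_mul_le_iff₀ (by positivity), ← div_eq_mul_inv, le_div_iff₀ this]
    exact h1
  obtain ⟨r, hr, intX, intB, hmain⟩ := exists_dual_sobolev (k := k) (by positivity)
    (by positivity) hG1 hGc (fun x => by simp only [hG]; ring) hgc
  have intA : Integrable (gradSqC f) := by
    refine (continuous_gradSqC hf).integrable_of_hasCompactSupport ?_
    refine (hfc.fderiv ℝ).mono fun x hx => ?_
    contrapose! hx
    have hx' : fderiv ℝ f x = 0 := by simpa using hx
    simp [gradSqC, pdC, hx']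
  have hXle : ∫ x, ‖fderiv ℝ g x‖ ^ 2 * (g x ^ 3)⁻¹ ≤
      4 * ((∫ x, gradSqC f x) + δ ^ 2 * ∫ x : E3, ((1 + ‖x‖ ^ 2) ^ 2)⁻¹) := by
    rw [← integral_const_mul, ← integral_add intA
      (integrable_inv_one_add_norm_sq_sq.const_mul _), ← integral_const_mul]
    refine integral_mono intX
      ((intA.add (integrable_inv_one_add_norm_sq_sq.const_mul _)).const_mul _) fun x => ?_
    have h0 := hρ0 x
    have hd : fderiv ℝ g x = -(ρ x ^ 2)⁻¹ • fderiv ℝ ρ x :=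
      ((hasDerivAt_inv h0.ne').comp_hasFDerivAt x
        (hρ1.differentiable one_ne_zero x).hasFDerivAt).fderiv
    have hle : ‖fderiv ℝ ρ x‖ ^ 2 ≤ _ := norm_fderiv_norm_sq_add_le hf x
    change ‖fderiv ℝ ρ x‖ ^ 2 ≤ 4 * ρ x * _ at hle
    have e : ‖fderiv ℝ g x‖ ^ 2 * (g x ^ 3)⁻¹ = ‖fderiv ℝ ρ x‖ ^ 2 / ρ x := by
      rw [hd, norm_smul, norm_neg, Real.norm_of_nonneg (by positivity)]
      simp only [hg]
      field_simp
    change ‖fderiv ℝ g x‖ ^ 2 * (g x ^ 3)⁻¹ ≤ _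
    rw [e, div_le_iff₀ h0]
    linarith
  have hBle : ∫ x, ‖f x‖ ^ 6 ≤ ∫ x, (g x ^ 3)⁻¹ := by
    refine integral_mono_of_nonneg (Filter.Eventually.of_forall fun x => by positivity) intB
      (Filter.Eventually.of_forall fun x => ?_)
    have h0 := hρ0 x
    have : (g x ^ 3)⁻¹ = ρ x ^ 3 := by simp [hg]
    simp only [this]
    calc ‖f x‖ ^ 6 = (‖f x‖ ^ 2) ^ 3 := by ring
      _ ≤ _ := by
        gcongr
        simp only [hρ]
        linarith [show 0 ≤ δ ^ 2 * (1 + ‖x‖ ^ 2)⁻¹ by positivity]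
  refine mul_sq_le_of_forall_amgm hr (integral_nonneg fun x => by positivity)
    (integral_nonneg fun x => by positivity) (hmain.trans ?_)
  gcongr

/-- Sharp Sobolev inequality for compactly supported `C¹` functions. -/
lemma sobolev_of_hasCompactSupport {f : E3 → ℂ} (hf : ContDiff ℝ 1 f)
    (hfc : HasCompactSupport f) :
    (∫ x, ‖f x‖ ^ 6) * (∫ x : E3, ((1 + ‖x‖ ^ 2 / 3) ^ 2)⁻¹) ^ 2 ≤
      16 * (∫ x, gradSqC f x) ^ 3 := by
  set J := ∫ x : E3, ((1 + ‖x‖ ^ 2) ^ 2)⁻¹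
  set A := ∫ x, gradSqC f x
  have lim : Filter.Tendsto (fun δ : ℝ => 16 * (A + δ ^ 2 * J) ^ 3) (nhdsWithin 0 (Set.Ioi 0))
      (nhds (16 * (A + 0 ^ 2 * J) ^ 3)) :=
    (Continuous.tendsto (by fun_prop) 0).mono_left nhdsWithin_le_nhds
  rw [zero_pow two_ne_zero, zero_mul, add_zero] at lim
  refine ge_of_tendsto lim ?_
  filter_upwards [self_mem_nhdsWithin] with δ hδ
  exact sobolev_regularized hf hfc hδ

lemma gradSqC_smul_le {f : E3 → ℂ} {χ : E3 → ℝ} {x : E3} (hf : DifferentiableAt ℝ f x)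
    (hχ : DifferentiableAt ℝ χ x) {M η : ℝ} (hη : 0 < η) (h1 : ‖χ x‖ ≤ 1)
    (hM : ‖fderiv ℝ χ x‖ ≤ M) :
    gradSqC (fun x => χ x • f x) x ≤
      (1 + η) * gradSqC f x + 3 * (1 + η⁻¹) * M ^ 2 * ‖f x‖ ^ 2 := by
  have hM0 : 0 ≤ M := (norm_nonneg _).trans hM
  have key : ∀ i, ‖pdC i (fun x => χ x • f x) x‖ ^ 2 ≤
      (1 + η) * ‖pdC i f x‖ ^ 2 + (1 + η⁻¹) * M ^ 2 * ‖f x‖ ^ 2 := by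
    intro i
    have h2 : pdC i (fun x => χ x • f x) x = χ x • pdC i f x + fderiv ℝ χ x (e3 i) • f x := by
      simp only [pdC]
      have hd : HasFDerivAt (fun x => χ x • f x) _ x := hχ.hasFDerivAt.smul hf.hasFDerivAt
      rw [hd.fderiv]
      simp
    have h3 : ‖fderiv ℝ χ x (e3 i)‖ ≤ M :=
      ((fderiv ℝ χ x).le_opNorm _).trans (by simpa [e3] using hM)
    have h4 : ‖pdC i (fun x => χ x • f x) x‖ ≤ ‖pdC i f x‖ + M * ‖f x‖ := by
      rw [h2]
      refine (norm_add_le _ _).trans ?_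
      rw [norm_smul, norm_smul]
      gcongr
      exact mul_le_of_le_one_left (norm_nonneg _) h1
    calc _ ≤ (‖pdC i f x‖ + M * ‖f x‖) ^ 2 := by gcongr
      _ ≤ _ := by
        have : 0 ≤ η⁻¹ * (η * ‖pdC i f x‖ - M * ‖f x‖) ^ 2 := by positivity
        have e : η⁻¹ * (η * ‖pdC i f x‖ - M * ‖f x‖) ^ 2 = η * ‖pdC i f x‖ ^ 2 -
          2 * ‖pdC i f x‖ * (M * ‖f x‖) + η⁻¹ * M ^ 2 * ‖f x‖ ^ 2 := by field_simp; ring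
        linarith
  simp only [gradSqC, Fin.sum_univ_three]
  linarith [key 0, key 1, key 2]

/-- Sharp Sobolev inequality for `C¹` functions in `H¹ ∩ L⁶`. -/
lemma sobolev_of_integrable {f : E3 → ℂ} (hf : ContDiff ℝ 1 f)
    (h2 : Integrable fun x => ‖f x‖ ^ 2) (h6 : Integrable fun x => ‖f x‖ ^ 6)
    (hA : Integrable (gradSqC f)) :
    (∫ x, ‖f x‖ ^ 6) * (∫ x : E3, ((1 + ‖x‖ ^ 2 / 3) ^ 2)⁻¹) ^ 2 ≤
      16 * (∫ x, gradSqC f x) ^ 3 := by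
  let ψ : ContDiffBump (0 : E3) := ⟨1, 2, one_pos, one_lt_two⟩
  have hψ1 : ContDiff ℝ 1 ψ := ψ.contDiff
  obtain ⟨K, hK⟩ := (hψ1.continuous_fderiv one_ne_zero).bounded_above_of_compact_support
    (ψ.hasCompactSupport.fderiv ℝ)
  have hK0 : 0 ≤ K := (norm_nonneg _).trans (hK 0)
  set χ : ℝ → E3 → ℝ := fun R x => ψ (R⁻¹ • x) with hχ
  have hχ1 : ∀ R, ContDiff ℝ 1 (χ R) := fun R => hψ1.comp (contDiff_const_smul _)
  have hχle : ∀ R x, ‖χ R x‖ ≤ 1 := fun R x => by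
    rw [Real.norm_of_nonneg ψ.nonneg]
    exact ψ.le_one
  have hχd : ∀ R, 0 < R → ∀ x, ‖fderiv ℝ (χ R) x‖ ≤ K * R⁻¹ := by
    intro R hR x
    have hd : HasFDerivAt (χ R) _ x :=
      (hψ1.differentiable one_ne_zero (R⁻¹ • x)).hasFDerivAt.comp x
        ((hasFDerivAt_id x).const_smul R⁻¹)
    rw [hd.fderiv]
    refine ContinuousLinearMap.opNorm_le_bound _ (by positivity) fun y => ?_
    simp only [ContinuousLinearMap.comp_apply, smul_apply,
      ContinuousLinearMap.id_apply]
    refine (ContinuousLinearMap.le_opNorm _ _).trans ?_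
    rw [norm_smul, Real.norm_of_nonneg (by positivity), ← mul_assoc]
    gcongr
    exact hK _
  have hcs : ∀ R, 0 < R → HasCompactSupport (χ R) := fun R hR =>
    ψ.hasCompactSupport.comp_smul (inv_ne_zero hR.ne')
  set F : ℝ → E3 → ℂ := fun R x => χ R x • f x with hF
  have hF1 : ∀ R, ContDiff ℝ 1 (F R) := fun R => (hχ1 R).smul hf
  have hFA : ∀ R, 0 < R → ∫ x, gradSqC (F R) x ≤
      (1 + R⁻¹) * (∫ x, gradSqC f x) + 3 * (R⁻¹ ^ 2 + R⁻¹) * K ^ 2 * ∫ x, ‖f x‖ ^ 2 := by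
    intro R hR
    rw [← integral_const_mul, ← integral_const_mul,
      ← integral_add (hA.const_mul _) (h2.const_mul _)]
    refine integral_mono_of_nonneg (Filter.Eventually.of_forall fun x => gradSqC_nonneg _ x)
      ((hA.const_mul _).add (h2.const_mul _)) (Filter.Eventually.of_forall fun x => ?_)
    have := gradSqC_smul_le (hf.differentiable one_ne_zero x)
      ((hχ1 R).differentiable one_ne_zero x) (inv_pos.mpr hR) (hχle R x) (hχd R hR x)
    refine this.trans (le_of_eq ?_)
    simp only [inv_inv]
    field_simp
  have hB : Filter.Tendsto (fun R => ∫ x, ‖F R x‖ ^ 6) Filter.atTop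
      (nhds (∫ x, ‖f x‖ ^ 6)) := by
    refine tendsto_integral_filter_of_dominated_convergence (fun x => ‖f x‖ ^ 6)
      (Filter.Eventually.of_forall fun R =>
        ((hF1 R).continuous.norm.pow 6).aestronglyMeasurable)
      (Filter.Eventually.of_forall fun R => Filter.Eventually.of_forall fun x => ?_) h6
      (Filter.Eventually.of_forall fun x => ?_)
    · rw [Real.norm_of_nonneg (by positivity)]
      gcongr
      simp only [hF]
      rw [norm_smul]
      exact mul_le_of_le_one_left (norm_nonneg _) (hχle R x)
    · refine tendsto_nhds_of_eventually_eq ?_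
      filter_upwards [Filter.eventually_gt_atTop ‖x‖, Filter.eventually_gt_atTop 0] with R hR hR0
      have : χ R x = 1 := by
        refine ψ.one_of_mem_closedBall ?_
        rw [mem_closedBall_zero_iff, norm_smul, Real.norm_of_nonneg (by positivity),
          inv_mul_le_iff₀ hR0]
        change ‖x‖ ≤ R * 1
        linarith
      simp [hF, this]
  have hinv : Filter.Tendsto (fun R : ℝ => R⁻¹) Filter.atTop (nhds 0) := tendsto_inv_atTop_zero
  have hrhs : Filter.Tendsto (fun R : ℝ => 16 * ((1 + R⁻¹) * (∫ x, gradSqC f x) +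
      3 * (R⁻¹ ^ 2 + R⁻¹) * K ^ 2 * ∫ x, ‖f x‖ ^ 2) ^ 3) Filter.atTop
      (nhds (16 * (∫ x, gradSqC f x) ^ 3)) := by
    have := (Continuous.tendsto (f := fun s : ℝ => 16 * ((1 + s) * (∫ x, gradSqC f x) +
      3 * (s ^ 2 + s) * K ^ 2 * ∫ x, ‖f x‖ ^ 2) ^ 3) (by fun_prop) 0).comp hinv
    simpa [Function.comp_def] using this
  refine le_of_tendsto_of_tendsto (hB.mul_const _) hrhs ?_
  filter_upwards [Filter.eventually_gt_atTop 0] with R hR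
  refine (sobolev_of_hasCompactSupport (hF1 R) ((hcs R hR).smul_right)).trans ?_
  have : 0 ≤ ∫ x, gradSqC (F R) x := integral_nonneg fun x => gradSqC_nonneg _ x
  gcongr
  exact hFA R hR

lemma W_sq (x : E3) : W x ^ 2 = (1 + ‖x‖ ^ 2 / 3)⁻¹ := by
  rw [W, ← Real.rpow_mul_natCast (by positivity)]
  norm_num [Real.rpow_neg_one]

lemma hasFDerivAt_W (x : E3) :
    HasFDerivAt W ((-(1 : ℝ) / 2 * (1 + ‖x‖ ^ 2 / 3) ^ (-(1 : ℝ) / 2 - 1)) •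
      ((1 / 3 : ℝ) • (2 • innerSL ℝ x))) x := by
  have h1 : HasFDerivAt (fun x : E3 => 1 + ‖x‖ ^ 2 / 3) ((1 / 3 : ℝ) • (2 • innerSL ℝ x)) x := by
    have := (((hasStrictFDerivAt_norm_sq x).hasFDerivAt.const_mul (1 / 3 : ℝ)).const_add 1)
    refine this.congr_of_eventuallyEq (Filter.Eventually.of_forall fun y => ?_)
    simp only
    ring
  exact h1.rpow_const (Or.inl (by positivity))

lemma pdR_W_sq (i : Fin 3) (x : E3) :
    pdR i W x ^ 2 = 1 / 9 * ((1 + ‖x‖ ^ 2 / 3) ^ 3)⁻¹ * x i ^ 2 := by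
  have h : ((1 + ‖x‖ ^ 2 / 3) ^ (-(1 : ℝ) / 2 - 1)) ^ 2 = ((1 + ‖x‖ ^ 2 / 3) ^ 3)⁻¹ := by
    rw [← Real.rpow_mul_natCast (by positivity), show (-(1 : ℝ) / 2 - 1) * (2 : ℕ) = -(3 : ℕ) by
      norm_num, Real.rpow_neg (by positivity), Real.rpow_natCast]
  have hi : inner ℝ x (e3 i) = x i := by simp [e3, EuclideanSpace.inner_single_right]
  rw [pdR, (hasFDerivAt_W x).fderiv, ← h]
  simp only [smul_apply, innerSL_apply_apply, hi, smul_eq_mul, nsmul_eq_mul]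
  ring

lemma gradSqR_W (x : E3) :
    gradSqR W x = 1 / 3 * (((1 + ‖x‖ ^ 2 / 3) ^ 2)⁻¹ - ((1 + ‖x‖ ^ 2 / 3) ^ 3)⁻¹) := by
  have h : ‖x‖ ^ 2 = ∑ i, x i ^ 2 := by simp [EuclideanSpace.norm_sq_eq]
  have h' : gradSqR W x = 1 / 9 * ((1 + ‖x‖ ^ 2 / 3) ^ 3)⁻¹ * ‖x‖ ^ 2 := by
    rw [h, Finset.mul_sum, ← h]
    exact Finset.sum_congr rfl fun i _ => pdR_W_sq i x
  rw [h']
  field_simp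
  ring

lemma gradSqC_Wc (x : E3) : gradSqC Wc x = gradSqR W x := by
  refine Finset.sum_congr rfl fun i _ => ?_
  have h : HasFDerivAt Wc (Complex.ofRealCLM.comp (fderiv ℝ W x)) x :=
    Complex.ofRealCLM.hasFDerivAt.comp x (hasFDerivAt_W x).differentiableAt.hasFDerivAt
  rw [pdC, h.fderiv, pdR]
  simp

lemma norm_Wc_pow_six (x : E3) : ‖Wc x‖ ^ 6 = ((1 + ‖x‖ ^ 2 / 3) ^ 3)⁻¹ := by
  have h : ‖Wc x‖ ^ 2 = W x ^ 2 := by simp [Wc]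
  rw [show ‖Wc x‖ ^ 6 = (‖Wc x‖ ^ 2) ^ 3 by ring, h, W_sq, inv_pow]

lemma integrable_inv_sq_talenti : Integrable fun x : E3 => ((1 + ‖x‖ ^ 2 / 3) ^ 2)⁻¹ := by
  refine integrable_of_abs_le (C := 9) ?_ fun x => ?_
  · exact Continuous.inv₀ (by fun_prop) fun x => by positivity
  · rw [abs_of_nonneg (by positivity), ← div_eq_mul_inv, inv_le_comm₀ (by positivity)
      (by positivity), inv_div, div_le_iff₀ (by positivity)]
    nlinarith [sq_nonneg ‖x‖]

lemma integrable_inv_cube_talenti : Integrable fun x : E3 => ((1 + ‖x‖ ^ 2 / 3) ^ 3)⁻¹ := by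
  refine integrable_inv_sq_talenti.mono' (Continuous.aestronglyMeasurable ?_)
    (Filter.Eventually.of_forall fun x => ?_)
  · exact Continuous.inv₀ (by fun_prop) fun x => by positivity
  · rw [Real.norm_of_nonneg (by positivity)]
    have : (1 : ℝ) ≤ 1 + ‖x‖ ^ 2 / 3 := by linarith [sq_nonneg ‖x‖]
    gcongr
    · norm_num

lemma integral_inv_cube_talenti_pos : 0 < ∫ x : E3, ((1 + ‖x‖ ^ 2 / 3) ^ 3)⁻¹ :=
  integral_pos_of_integrable_nonneg_nonzero (x := 0)
    (Continuous.inv₀ (by fun_prop) fun x => by positivity) integrable_inv_cube_talenti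
    (fun x => by positivity) (by simp)

lemma hasDerivAt_neg_cube_div (r : ℝ) :
    HasDerivAt (fun r : ℝ => -(r ^ 3 / (1 + r ^ 2 / 3) ^ 2))
      (r ^ 2 * (((1 + r ^ 2 / 3) ^ 2)⁻¹ - 4 * ((1 + r ^ 2 / 3) ^ 3)⁻¹)) r := by
  have h0 : (1 + r ^ 2 / 3) ^ 2 ≠ 0 := by positivity
  have h1 : HasDerivAt (fun r : ℝ => (1 + r ^ 2 / 3) ^ 2)
      (2 * (1 + r ^ 2 / 3) * (2 * r / 3)) r := by
    have := ((((hasDerivAt_id r).fun_pow 2).div_const 3).const_add 1).fun_pow 2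
    simpa using this
  have := (((hasDerivAt_id r).fun_pow 3).div h1 h0).fun_neg
  refine this.congr_deriv ?_
  simp only [id]
  field_simp
  push_cast
  ring

lemma tendsto_neg_cube_div :
    Filter.Tendsto (fun r : ℝ => -(r ^ 3 / (1 + r ^ 2 / 3) ^ 2)) Filter.atTop (nhds 0) := by
  rw [← neg_zero]
  refine Filter.Tendsto.neg ?_
  have h9 : Filter.Tendsto (fun r : ℝ => 9 * r⁻¹) Filter.atTop (nhds 0) := by
    simpa using tendsto_inv_atTop_zero.const_mul (9 : ℝ)
  refine tendsto_of_tendsto_of_tendsto_of_le_of_le' tendsto_const_nhds h9 ?_ ?_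
  · filter_upwards [Filter.eventually_gt_atTop 0] with r hr
    positivity
  · filter_upwards [Filter.eventually_gt_atTop 0] with r hr
    rw [div_le_iff₀ (by positivity)]
    have e : 9 * r⁻¹ * (1 + r ^ 2 / 3) ^ 2 = r ^ 3 + (6 * r + 9 * r⁻¹) := by
      field_simp
      ring
    rw [e]
    have : 0 ≤ 6 * r + 9 * r⁻¹ := by positivity
    linarith

lemma integral_inv_sq_talenti :
    ∫ x : E3, ((1 + ‖x‖ ^ 2 / 3) ^ 2)⁻¹ = 4 * ∫ x : E3, ((1 + ‖x‖ ^ 2 / 3) ^ 3)⁻¹ := by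
  set φ : ℝ → ℝ := fun r => ((1 + r ^ 2 / 3) ^ 2)⁻¹ - 4 * ((1 + r ^ 2 / 3) ^ 3)⁻¹ with hφ
  have hφ_int : Integrable fun x : E3 => φ ‖x‖ :=
    integrable_inv_sq_talenti.sub (integrable_inv_cube_talenti.const_mul 4)
  have hdim : Module.finrank ℝ E3 - 1 = 2 := by simp
  have hφr : IntegrableOn (fun r : ℝ => r ^ 2 * φ r) (Set.Ioi 0) := by
    have := (integrable_fun_norm_addHaar (volume : Measure E3)).mp hφ_int
    simpa only [hdim, smul_eq_mul] using this
  have h0 : ∫ x : E3, φ ‖x‖ = 0 := by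
    rw [integral_fun_norm_addHaar (volume : Measure E3) φ, hdim]
    simp only [smul_eq_mul]
    rw [integral_Ioi_of_hasDerivAt_of_tendsto' (fun r _ => hasDerivAt_neg_cube_div r) hφr
      tendsto_neg_cube_div]
    simp
  have h1 : ∫ x : E3, φ ‖x‖ = (∫ x : E3, ((1 + ‖x‖ ^ 2 / 3) ^ 2)⁻¹) -
      4 * ∫ x : E3, ((1 + ‖x‖ ^ 2 / 3) ^ 3)⁻¹ := by
    rw [← integral_const_mul]
    exact integral_sub integrable_inv_sq_talenti (integrable_inv_cube_talenti.const_mul 4)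
  linarith
/-- Threshold rigidity: no `H¹`-function has cubic–quintic energy `E^c(W)`
together with `‖∇f‖_{L²} = ‖∇W‖_{L²}`. -/
theorem threshold_rigidity :
    ¬ ∃ f : E3 → ℂ, ContDiff ℝ 1 f ∧
      Integrable (fun x : E3 => ‖f x‖ ^ 2) ∧
      Integrable (fun x : E3 => ‖f x‖ ^ 4) ∧
      Integrable (fun x : E3 => ‖f x‖ ^ 6) ∧
      Integrable (gradSqC f) ∧
      Ecq f = Ecrit Wc ∧
      (∫ x : E3, gradSqC f x) = ∫ x : E3, gradSqR W x := by
  rintro ⟨f, hf, h2, h4, h6, hA, hE, hG⟩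
  have hS := sobolev_of_integrable hf h2 h6 hA
  have hD := integral_inv_sq_talenti
  have hBpos := integral_inv_cube_talenti_pos
  have hGW : ∫ x, gradSqR W x = ∫ x : E3, ((1 + ‖x‖ ^ 2 / 3) ^ 3)⁻¹ := by
    simp_rw [gradSqR_W]
    rw [integral_const_mul, integral_sub integrable_inv_sq_talenti integrable_inv_cube_talenti, hD]
    ring
  have hintW : Integrable (gradSqR W) := by
    refine ((integrable_inv_sq_talenti.sub integrable_inv_cube_talenti).const_mul (1 / 3)).congr
      (Filter.Eventually.of_forall fun x => ?_)
    exact (gradSqR_W x).symm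
  have hEW : Ecrit Wc = 1 / 2 * (∫ x, gradSqR W x) -
      1 / 6 * ∫ x : E3, ((1 + ‖x‖ ^ 2 / 3) ^ 3)⁻¹ := by
    simp only [Ecrit, gradSqC_Wc, norm_Wc_pow_six]
    rw [integral_sub (hintW.const_mul _) (integrable_inv_cube_talenti.const_mul _),
      integral_const_mul, integral_const_mul]
  have hEf : Ecq f = 1 / 2 * (∫ x, gradSqC f x) - 1 / 6 * (∫ x, ‖f x‖ ^ 6) +
      1 / 4 * ∫ x, ‖f x‖ ^ 4 := by
    have hs : Integrable fun x => 1 / 2 * gradSqC f x - 1 / 6 * ‖f x‖ ^ 6 :=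
      (hA.const_mul _).sub (h6.const_mul _)
    rw [Ecq, integral_add hs (h4.const_mul _), integral_sub (hA.const_mul _) (h6.const_mul _),
      integral_const_mul, integral_const_mul, integral_const_mul]
  rw [hEf, hEW, hG] at hE
  rw [hG, hGW, hD] at hS
  set B := ∫ x : E3, ((1 + ‖x‖ ^ 2 / 3) ^ 3)⁻¹
  have hle : ∫ x, ‖f x‖ ^ 6 ≤ B := by
    have : (∫ x, ‖f x‖ ^ 6) * (16 * B ^ 2) ≤ B * (16 * B ^ 2) := by linarith
    exact le_of_mul_le_mul_right this (by positivity)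
  have h4nn : 0 ≤ ∫ x, ‖f x‖ ^ 4 := integral_nonneg fun x => by positivity
  have h40 : ∫ x, ‖f x‖ ^ 4 = 0 := by linarith
  have hf0 : (fun x => ‖f x‖ ^ 4) =ᵐ[volume] 0 :=
    (integral_eq_zero_iff_of_nonneg (fun x => by positivity) h4).mp h40
  have h60 : ∫ x, ‖f x‖ ^ 6 = 0 := by
    refine integral_eq_zero_of_ae ?_
    filter_upwards [hf0] with x hx
    have : f x = 0 := by simpa using hx
    simp [this]
  linarith
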